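/- arXiv:2004.06462 — 4 statements merged into one kernel-verified Lean document; each statement's English description precedes it below -/
import Mathlib

section
/- Reproducing property of the kernel K_{β,η} (Proposition 2.1): let β, η > 0, fix I ∈ ℍ with I² = -1, let c : ℕ → ℍ satisfy Σ_{n} γ_n^{β,η} ‖c_n‖² < ∞, and define f(q) = Σ_{n=0}^∞ qⁿ c_n for quaternions q with ‖q‖ < 1. Then for every q ∈ ℍ with ‖q‖ < 1, ∫∫_{{u²+v²<1}} conj(K_{β,η}(u+vI, q)) · f(u+vI) · ω_{β,η}(u²+v²) du dv = f(q), where conj is quaternionic conjugation. -/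
open MeasureTheory Real Quaternion

/-- `γ_n^{β,η} = Γ(η)Γ(β+n)/Γ(β+η+n)`. -/
noncomputable def gamCoef (β η : ℝ) (n : ℕ) : ℝ :=
  Real.Gamma η * Real.Gamma (β + n) / Real.Gamma (β + η + n)

/-- Weight `ω_{β,η}(t) = t^{β-1}(1-t)^{η-1}`. -/
noncomputable def weightBeta (β η t : ℝ) : ℝ := t ^ (β - 1) * (1 - t) ^ (η - 1)

/-- Pochhammer symbol `(a)_k`. -/
noncomputable def poch (a : ℝ) (k : ℕ) : ℝ := ∏ i ∈ Finset.range k, (a + i)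

/-- The reproducing kernel `K_{β,η}(p,q)`. -/
noncomputable def Kker (β η : ℝ) (p q : ℍ[ℝ]) : ℍ[ℝ] :=
  (Real.Gamma (β + η) / (π * Real.Gamma η * Real.Gamma β)) •
    ∑' k : ℕ, (poch (β + η) k / poch β k) • (p ^ k * (star q) ^ k)


open Filter Topology Set

lemma starI {I : ℍ[ℝ]} (hI : I ^ 2 = -1) : star I = -I := by
  have h1 := congrArg QuaternionAlgebra.re hI
  have h2 := congrArg QuaternionAlgebra.imI hI
  have h3 := congrArg QuaternionAlgebra.imJ hI
  have h4 := congrArg QuaternionAlgebra.imK hI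
  simp [pow_two] at h1 h2 h3 h4
  have hre : I.re = 0 := by
    by_contra h
    have e2 : I.imI = 0 := by
      have : I.re * I.imI = 0 := by linarith
      simpa [h] using this
    have e3 : I.imJ = 0 := by
      have : I.re * I.imJ = 0 := by linarith
      simpa [h] using this
    have e4 : I.imK = 0 := by
      have : I.re * I.imK = 0 := by linarith
      simpa [h] using this
    rw [e2, e3, e4] at h1
    nlinarith [mul_self_nonneg I.re]
  ext <;> simp [hre]

noncomputable def emb (I : ℍ[ℝ]) (hI : I ^ 2 = -1) : ℂ →ₐ[ℝ] ℍ[ℝ] :=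
  Complex.lift ⟨I, by rw [← pow_two, hI]⟩

lemma emb_apply (I : ℍ[ℝ]) (hI : I ^ 2 = -1) (z : ℂ) :
    emb I hI z = (z.re : ℍ[ℝ]) + z.im • I := rfl

lemma emb_conj (I : ℍ[ℝ]) (hI : I ^ 2 = -1) (z : ℂ) :
    star (emb I hI z) = emb I hI (star z) := by
  simp [emb_apply, starI hI]

lemma star_mul_self_smul (a : ℍ[ℝ]) : star a * a = (‖a‖ ^ 2) • (1 : ℍ[ℝ]) := by
  rw [Quaternion.star_mul_self, Quaternion.normSq_eq_norm_mul_self, pow_two]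
  ext <;> simp

lemma norm_emb (I : ℍ[ℝ]) (hI : I ^ 2 = -1) (z : ℂ) : ‖emb I hI z‖ = ‖z‖ := by
  have h : star (emb I hI z) * emb I hI z = (‖z‖ ^ 2) • (1 : ℍ[ℝ]) := by
    rw [emb_conj, ← map_mul]
    have : star z * z = ((‖z‖ ^ 2 : ℝ) : ℂ) := by
      rw [Complex.star_def, Complex.conj_mul']; push_cast; rfl
    rw [this, emb_apply, Complex.ofReal_re, Complex.ofReal_im]
    generalize ‖z‖ ^ 2 = t
    ext <;> simp
  rw [star_mul_self_smul] at h
  have := congrArg QuaternionAlgebra.re h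
  simp at this
  exact this

/-- the point of polar coordinates `(r, θ)`. -/
noncomputable def pol (I : ℍ[ℝ]) (r θ : ℝ) : ℍ[ℝ] :=
  ((r * Real.cos θ : ℝ) : ℍ[ℝ]) + (r * Real.sin θ) • I

lemma pol_eq (I : ℍ[ℝ]) (hI : I ^ 2 = -1) (r θ : ℝ) :
    pol I r θ = emb I hI (r * Complex.exp (θ * Complex.I)) := by
  rw [emb_apply, pol]
  simp [Complex.exp_ofReal_mul_I_re, Complex.exp_ofReal_mul_I_im]

lemma norm_pol (I : ℍ[ℝ]) (hI : I ^ 2 = -1) {r : ℝ} (hr : 0 ≤ r) (θ : ℝ) : ‖pol I r θ‖ = r := by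
  rw [pol_eq I hI, norm_emb, norm_mul, Complex.norm_exp_ofReal_mul_I]
  simp [abs_of_nonneg hr]

lemma continuous_pol (I : ℍ[ℝ]) : Continuous fun x : ℝ × ℝ => pol I x.1 x.2 := by
  unfold pol
  have : Continuous fun x : ℝ × ℝ => ((x.1 * Real.cos x.2 : ℝ) : ℍ[ℝ]) :=
    Quaternion.continuous_coe.comp (by fun_prop)
  fun_prop

lemma pol_monomial (I : ℍ[ℝ]) (hI : I ^ 2 = -1) (r θ : ℝ) (k n : ℕ) :
    star (pol I r θ) ^ k * pol I r θ ^ n =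
      r ^ (k + n) • emb I hI (Complex.exp ((((n : ℂ) - k) * Complex.I) * θ)) := by
  rw [pol_eq I hI, emb_conj, ← map_pow, ← map_pow, ← map_mul, ← map_smul]
  congr 1
  have : star ((r : ℂ) * Complex.exp (θ * Complex.I)) = r * Complex.exp (-(θ * Complex.I)) := by
    simp [← Complex.exp_conj]
  rw [this, mul_pow, mul_pow, ← Complex.exp_nat_mul, ← Complex.exp_nat_mul]
  rw [Complex.real_smul, show ((n : ℂ) - k) * Complex.I * θ = k * -(θ * Complex.I) + n * (θ * Complex.I) by ring, Complex.exp_add]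
  push_cast
  ring

lemma integral_exp_circle (m : ℤ) :
    ∫ θ in Ioo (-π) π, Complex.exp (((m : ℂ) * Complex.I) * θ) = if m = 0 then (2 * π : ℝ) else 0 := by
  rw [← integral_Ioc_eq_integral_Ioo, ← intervalIntegral.integral_of_le (by linarith [pi_pos])]
  split_ifs with h
  · subst h; simp; ring
  · rw [integral_exp_mul_complex (by simp [h])]
    rw [Complex.ofReal_zero, div_eq_zero_iff]; left
    rw [sub_eq_zero, Complex.exp_eq_exp_iff_exists_int]
    exact ⟨m, by push_cast; ring⟩

lemma integral_monomial (I : ℍ[ℝ]) (hI : I ^ 2 = -1) (r : ℝ) (k n : ℕ) :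
    ∫ θ in Ioo (-π) π, star (pol I r θ) ^ k * pol I r θ ^ n =
      if k = n then ((2 * π) * r ^ (2 * n)) • (1 : ℍ[ℝ]) else 0 := by
  simp_rw [pol_monomial I hI]
  rw [integral_smul]
  let L : ℂ →L[ℝ] ℍ[ℝ] := (emb I hI).toLinearMap.toContinuousLinearMap
  have h1 : ∫ θ in Ioo (-π) π, emb I hI (Complex.exp ((((n : ℂ) - k) * Complex.I) * θ)) =
      emb I hI (∫ θ in Ioo (-π) π, Complex.exp ((((n : ℂ) - k) * Complex.I) * θ)) := by
    refine L.integral_comp_comm (φ := fun θ : ℝ => Complex.exp ((((n : ℂ) - k) * Complex.I) * θ)) ?_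
    exact (Continuous.integrableOn_Icc (by fun_prop)).mono_set Ioo_subset_Icc_self
  rw [h1]
  have := integral_exp_circle ((n : ℤ) - k)
  push_cast at this
  rw [this]
  by_cases h : k = n
  · subst h
    simp only [sub_self, if_true]
    rw [emb_apply, ← two_mul]
    ext <;> simp; ring
  · have : (n : ℤ) - k ≠ 0 := by omega
    simp [h, this]

lemma circle_lemma (I : ℍ[ℝ]) (hI : I ^ 2 = -1) {r : ℝ} (hr : 0 ≤ r) (A C : ℕ → ℍ[ℝ])
    (hA : Summable fun k => ‖A k‖ * r ^ k) (hC : Summable fun k => ‖C k‖ * r ^ k) :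
    ∫ θ in Ioo (-π) π, (∑' k, A k * star (pol I r θ) ^ k) * (∑' n, pol I r θ ^ n * C n) =
      ∑' n, ((2 * π) * r ^ (2 * n)) • (A n * C n) := by
  have hpA : ∀ θ, Summable fun k => ‖A k * star (pol I r θ) ^ k‖ := by
    intro θ; simpa [norm_pol I hI hr] using hA
  have hpC : ∀ θ, Summable fun k => ‖pol I r θ ^ k * C k‖ := by
    intro θ; simpa [norm_pol I hI hr, mul_comm] using hC
  simp_rw [fun θ => tsum_mul_tsum_of_summable_norm (hpA θ) (hpC θ)]
  have cp : Continuous fun θ => pol I r θ := (continuous_pol I).comp (by fun_prop : Continuous fun θ : ℝ => (r, θ))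
  rw [← integral_tsum_of_summable_integral_norm]
  · have : ∀ z : ℕ × ℕ, ∫ θ in Ioo (-π) π, A z.1 * star (pol I r θ) ^ z.1 * (pol I r θ ^ z.2 * C z.2) =
        if z.1 = z.2 then ((2 * π) * r ^ (2 * z.2)) • (A z.2 * C z.2) else 0 := by
      intro z
      let L : ℍ[ℝ] →L[ℝ] ℍ[ℝ] := (LinearMap.mulLeftRight ℝ (A z.1, C z.2)).toContinuousLinearMap
      have hL : ∀ x, L x = A z.1 * x * C z.2 := fun x => rfl
      have e := L.integral_comp_comm (μ := volume.restrict (Ioo (-π) π)) (φ := fun θ => star (pol I r θ) ^ z.1 * pol I r θ ^ z.2)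
        ((Continuous.integrableOn_Icc (by fun_prop)).mono_set Ioo_subset_Icc_self)
      rw [integral_monomial I hI] at e
      simp only [hL] at e
      simp only [mul_assoc] at e ⊢
      rw [e]
      split_ifs with h
      · rw [h]; simp
      · simp
    simp_rw [this]
    have hinj : Function.Injective fun n : ℕ => (n, n) := fun a b h => by simpa using h
    rw [← hinj.tsum_eq]
    · simp
    · rintro ⟨a, b⟩ h
      by_cases hab : a = b
      · exact ⟨a, by simp [hab]⟩
      · simp [hab] at h
  · intro z
    exact (Continuous.integrableOn_Icc (by fun_prop)).mono_set Ioo_subset_Icc_self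
  · simp only [norm_mul, norm_pow, Quaternion.norm_star, norm_pol I hI hr]
    have := (hA.mul_of_nonneg hC (fun _ => by positivity) (fun _ => by positivity)).mul_left (volume.real (Ioo (-π) π))
    refine (summable_congr fun z => ?_).mpr this
    rw [MeasureTheory.setIntegral_const, smul_eq_mul]
    ring



lemma gamCoef_pos {β η : ℝ} (hβ : 0 < β) (hη : 0 < η) (n : ℕ) : 0 < gamCoef β η n := by
  unfold gamCoef
  have := Real.Gamma_pos_of_pos hη
  have := Real.Gamma_pos_of_pos (show 0 < β + n by positivity)
  have := Real.Gamma_pos_of_pos (show 0 < β + η + n by positivity)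
  positivity

lemma poch_pos {a : ℝ} (ha : 0 < a) (n : ℕ) : 0 < poch a n :=
  Finset.prod_pos fun i _ => by positivity

lemma poch_gamma {a : ℝ} (ha : 0 < a) (n : ℕ) : Real.Gamma (a + n) = poch a n * Real.Gamma a := by
  induction n with
  | zero => simp [poch]
  | succ k ih =>
    rw [poch, Finset.prod_range_succ, ← poch]
    push_cast
    rw [← add_assoc, Real.Gamma_add_one (by positivity), ih]
    ring

lemma coef_eq {β η : ℝ} (hβ : 0 < β) (hη : 0 < η) (n : ℕ) :
    (Real.Gamma (β + η) / (π * Real.Gamma η * Real.Gamma β)) * (poch (β + η) n / poch β n) =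
      (π * gamCoef β η n)⁻¹ := by
  unfold gamCoef
  have h1 := (Real.Gamma_pos_of_pos hη).ne'
  have h2 := (Real.Gamma_pos_of_pos hβ).ne'
  have h3 := (Real.Gamma_pos_of_pos (add_pos hβ hη)).ne'
  have h4 := (poch_pos hβ n).ne'
  have h5 := (poch_pos (add_pos hβ hη) n).ne'
  rw [poch_gamma hβ, poch_gamma (add_pos hβ hη)]
  field_simp

lemma gamCoef_succ {β η : ℝ} (hβ : 0 < β) (hη : 0 < η) (n : ℕ) :
    (gamCoef β η (n + 1))⁻¹ = (gamCoef β η n)⁻¹ * ((β + η + n) / (β + n)) := by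
  unfold gamCoef
  have h1 := (Real.Gamma_pos_of_pos hη).ne'
  have h2 := (Real.Gamma_pos_of_pos (show 0 < β + n by positivity)).ne'
  have h3 := (Real.Gamma_pos_of_pos (show 0 < β + η + n by positivity)).ne'
  push_cast
  rw [← add_assoc, ← add_assoc, Real.Gamma_add_one (by positivity), Real.Gamma_add_one (by positivity)]
  have : β + n ≠ 0 := by positivity
  have : β + η + n ≠ 0 := by positivity
  field_simp

lemma summable_inv_gam {β η : ℝ} (hβ : 0 < β) (hη : 0 < η) {x : ℝ} (hx0 : 0 ≤ x) (hx : x < 1) :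
    Summable fun n => (gamCoef β η n)⁻¹ * x ^ n := by
  obtain ⟨ρ, h1, h2⟩ := exists_between hx
  refine summable_of_ratio_norm_eventually_le h2 ?_
  have hlim : Tendsto (fun n : ℕ => x * ((β + η + n) / (β + n))) atTop (𝓝 (x * 1)) := by
    refine Tendsto.const_mul _ ?_
    have h : Tendsto (fun n : ℕ => 1 + η / (β + n)) atTop (𝓝 (1 + 0)) := by
      refine Tendsto.const_add _ ?_
      refine Tendsto.const_div_atTop ?_ _
      exact tendsto_atTop_add_const_left _ _ tendsto_natCast_atTop_atTop
    rw [add_zero] at h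
    refine h.congr fun n => ?_
    have : β + n ≠ 0 := by positivity
    field_simp
    ring
  rw [mul_one] at hlim
  filter_upwards [hlim.eventually_le_const h1] with n hn
  have hg := gamCoef_pos hβ hη n
  have hg' := gamCoef_pos hβ hη (n+1)
  rw [Real.norm_of_nonneg (by positivity), Real.norm_of_nonneg (by positivity), gamCoef_succ hβ hη, pow_succ]
  calc _ = (x * ((β + η + n) / (β + n))) * ((gamCoef β η n)⁻¹ * x ^ n) := by ring
    _ ≤ _ := by gcongr

lemma summable_coef {β η : ℝ} (hβ : 0 < β) (hη : 0 < η) {x : ℝ} (hx0 : 0 ≤ x) (hx : x < 1)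
    {c : ℕ → ℍ[ℝ]} (hc : Summable fun n : ℕ => gamCoef β η n * ‖c n‖ ^ 2) :
    Summable fun n => ‖c n‖ * x ^ n := by
  have h2 := summable_inv_gam hβ hη (sq_nonneg x) (by nlinarith)
  refine Summable.of_nonneg_of_le (fun n => by positivity) (fun n => ?_) (hc.add h2)
  have hg := gamCoef_pos hβ hη n
  have e : (gamCoef β η n)⁻¹ * (x ^ 2) ^ n = gamCoef β η n * ((gamCoef β η n)⁻¹ * x ^ n) ^ 2 := by
    field_simp; ring
  have e2 : ‖c n‖ * x ^ n = gamCoef β η n * (‖c n‖ * ((gamCoef β η n)⁻¹ * x ^ n)) := by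
    field_simp
  rw [e, e2, ← mul_add]
  have h3 : 0 ≤ ‖c n‖ * ((gamCoef β η n)⁻¹ * x ^ n) := by positivity
  gcongr
  nlinarith [sq_nonneg (‖c n‖ - ((gamCoef β η n)⁻¹ * x ^ n))]

lemma beta_real {a b : ℝ} (ha : 0 < a) (hb : 0 < b) :
    IntegrableOn (fun t : ℝ => t ^ (a - 1) * (1 - t) ^ (b - 1)) (Ioo 0 1) ∧
    ∫ t in Ioo (0:ℝ) 1, t ^ (a - 1) * (1 - t) ^ (b - 1) = 
      Real.Gamma a * Real.Gamma b / Real.Gamma (a + b) := by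
  have hc := Complex.betaIntegral_convergent (u := a) (v := b) (by simpa) (by simpa)
  rw [intervalIntegrable_iff_integrableOn_Ioo_of_le (by simp)] at hc
  have hcongr : ∀ x ∈ Ioo (0:ℝ) 1, RCLike.re ((x : ℂ) ^ ((a : ℂ) - 1) * (1 - (x : ℂ)) ^ ((b : ℂ) - 1)) =
      x ^ (a - 1) * (1 - x) ^ (b - 1) := by
    intro x hx
    norm_cast
    rw [← Complex.ofReal_cpow hx.1.le, ← Complex.ofReal_cpow (by linarith [hx.2]), RCLike.re_to_complex,
        Complex.re_mul_ofReal, Complex.ofReal_re]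
  constructor
  · exact (IntegrableOn.congr_fun hc.re hcongr measurableSet_Ioo)
  · rw [← setIntegral_congr_fun measurableSet_Ioo hcongr, integral_re hc]
    have := ProbabilityTheory.beta_eq_betaIntegralReal a b ha hb
    rw [ProbabilityTheory.beta] at this
    rw [this, Complex.betaIntegral, intervalIntegral.integral_of_le (by norm_num),
      integral_Ioc_eq_integral_Ioo]
    rfl

/-- radial weight -/
noncomputable def wr (β η : ℝ) (n : ℕ) (r : ℝ) : ℝ := r * weightBeta β η (r ^ 2) * r ^ (2 * n)

lemma wr_nonneg (β η : ℝ) (n : ℕ) {r : ℝ} (hr : r ∈ Ioo (0 : ℝ) 1) : 0 ≤ wr β η n r := by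
  have := hr.1
  have : 0 ≤ 1 - r ^ 2 := by nlinarith [hr.2]
  unfold wr weightBeta
  positivity

lemma wr_integral {β η : ℝ} (hβ : 0 < β) (hη : 0 < η) (n : ℕ) :
    IntegrableOn (wr β η n) (Ioo 0 1) ∧ ∫ r in Ioo (0:ℝ) 1, wr β η n r = gamCoef β η n / 2 := by
  obtain ⟨h1, h2⟩ := beta_real (a := β + n) (b := η) (by positivity) hη
  set g : ℝ → ℝ := (Ioo (0:ℝ) 1).indicator (fun t => t ^ (β + n - 1) * (1 - t) ^ (η - 1)) with hg
  have hsub : Ioo (0:ℝ) 1 ⊆ Ioi 0 := fun x hx => hx.1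
  have key : ∀ r ∈ Ioi (0:ℝ), (r ^ ((2:ℝ) - 1)) • g (r ^ (2:ℝ)) = (Ioo (0:ℝ) 1).indicator (wr β η n) r := by
    intro r hr
    have hr : 0 < r := hr
    rw [show (2:ℝ) - 1 = 1 by norm_num, Real.rpow_one, Real.rpow_two, hg]
    by_cases h : r < 1
    · rw [indicator_of_mem (show r ^ 2 ∈ Ioo (0:ℝ) 1 from ⟨by positivity, by nlinarith⟩),
        indicator_of_mem (show r ∈ Ioo (0:ℝ) 1 from ⟨hr, h⟩)]
      unfold wr weightBeta
      rw [show β + n - 1 = (β - 1) + n by ring, Real.rpow_add (by positivity), Real.rpow_natCast, ← pow_mul, smul_eq_mul]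
      ring
    · rw [indicator_of_notMem (fun h' => h (by nlinarith [h'.2])), indicator_of_notMem (fun h' => h h'.2)]
      simp
  have gi : IntegrableOn g (Ioi 0) := by
    rw [hg, integrableOn_indicator_iff measurableSet_Ioo, inter_eq_left.mpr hsub]
    exact h1
  have gI : ∫ t in Ioi 0, g t = gamCoef β η n := by
    rw [hg, setIntegral_indicator measurableSet_Ioo, inter_eq_right.mpr hsub, h2]
    unfold gamCoef
    rw [show β + η + n = β + n + η by ring, mul_comm (Real.Gamma η)]
  constructor
  · have := (integrableOn_Ioi_comp_rpow_iff' g (two_ne_zero)).mpr gi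
    have := this.congr_fun key measurableSet_Ioi
    rwa [integrableOn_indicator_iff measurableSet_Ioo, inter_eq_left.mpr hsub] at this
  · have := integral_comp_rpow_Ioi g (two_ne_zero (α := ℝ))
    simp_rw [mul_smul] at this
    rw [integral_smul, setIntegral_congr_fun measurableSet_Ioi key, gI, setIntegral_indicator measurableSet_Ioo, inter_eq_right.mpr hsub] at this
    simp at this
    linarith

lemma integrable_tsum_aux {α : Type*} [MeasurableSpace α] {μ : Measure α} {F : ℕ → α → ℍ[ℝ]}
    (hF_int : ∀ i, Integrable (F i) μ) (hF_sum : Summable fun i ↦ ∫ a, ‖F i a‖ ∂μ)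
    (hs : ∀ᵐ a ∂μ, Summable fun i => ‖F i a‖) :
    Integrable (fun a => ∑' i, F i a) μ := by
  refine ⟨?_, ?_⟩
  · refine aestronglyMeasurable_of_tendsto_ae (u := atTop) (f := fun N a => ∑ i ∈ Finset.range N, F i a)
      (fun N => ?_) ?_
    · exact (integrable_finsetSum _ fun i _ => hF_int i).1
    · filter_upwards [hs] with a ha
      exact ha.of_norm.hasSum.tendsto_sum_nat
  · unfold HasFiniteIntegral
    calc ∫⁻ a, ‖∑' i, F i a‖ₑ ∂μ ≤ ∫⁻ a, ∑' i, ‖F i a‖ₑ ∂μ := by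
          refine lintegral_mono_ae ?_
          filter_upwards [hs] with a ha
          exact enorm_tsum_le_tsum_enorm
      _ = ∑' i, ∫⁻ a, ‖F i a‖ₑ ∂μ := lintegral_tsum fun i => (hF_int i).1.enorm
      _ < ⊤ := by
        have (i : ℕ) : ∫⁻ a, ‖F i a‖ₑ ∂μ = ENNReal.ofReal (∫ a, ‖F i a‖ ∂μ) :=
          (ofReal_integral_norm_eq_lintegral_enorm (hF_int i)).symm
        simp_rw [this]
        exact hF_sum.tsum_ofReal_lt_top

lemma radial {β η : ℝ} (hβ : 0 < β) (hη : 0 < η) (D : ℕ → ℍ[ℝ])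
    (hD : Summable fun n => gamCoef β η n * ‖D n‖)
    (hD' : ∀ r ∈ Ioo (0:ℝ) 1, Summable fun n => r ^ (2 * n) * ‖D n‖) :
    IntegrableOn (fun r => ∑' n, wr β η n r • D n) (Ioo 0 1) ∧
    ∫ r in Ioo (0:ℝ) 1, ∑' n, wr β η n r • D n = ∑' n, (gamCoef β η n / 2) • D n := by
  have h1 : ∀ n, IntegrableOn (fun r => wr β η n r • D n) (Ioo 0 1) := fun n =>
    (wr_integral hβ hη n).1.smul_const _
  have h2 : Summable fun n => ∫ r in Ioo (0:ℝ) 1, ‖wr β η n r • D n‖ := by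
    have : ∀ n, ∫ r in Ioo (0:ℝ) 1, ‖wr β η n r • D n‖ = gamCoef β η n / 2 * ‖D n‖ := by
      intro n
      rw [← (wr_integral hβ hη n).2, ← integral_mul_const]
      refine setIntegral_congr_fun measurableSet_Ioo fun r hr => ?_
      rw [norm_smul, Real.norm_of_nonneg (wr_nonneg β η n hr)]
    simp_rw [this]
    refine (summable_congr fun n => ?_).mpr (hD.mul_left (1/2))
    ring
  constructor
  · refine integrable_tsum_aux h1 h2 ?_
    refine ae_restrict_of_forall_mem measurableSet_Ioo fun r hr => ?_
    refine (summable_congr fun n => ?_).mpr ((hD' r hr).mul_left (r * weightBeta β η (r ^ 2)))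
    rw [norm_smul, Real.norm_of_nonneg (wr_nonneg β η n hr), wr]
    ring
  · rw [← integral_tsum_of_summable_integral_norm h1 h2]
    congr 1; ext1 n
    rw [integral_smul_const, (wr_integral hβ hη n).2]

/-- polar measure on the punctured disc -/
noncomputable def mupol : Measure (ℝ × ℝ) :=
  (volume.restrict (Ioo (0:ℝ) 1)).prod (volume.restrict (Ioo (-π) π))

lemma mupol_eq : mupol = volume.restrict (Ioo (0:ℝ) 1 ×ˢ Ioo (-π) π) := by
  rw [mupol, Measure.prod_restrict]; rfl

lemma ae_mupol {P : ℝ × ℝ → Prop} (h : ∀ x : ℝ × ℝ, x.1 ∈ Ioo (0:ℝ) 1 → P x) : ∀ᵐ x ∂mupol, P x := by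
  rw [mupol_eq]
  exact ae_restrict_of_forall_mem (measurableSet_Ioo.prod measurableSet_Ioo) fun x hx => h x hx.1

lemma meas_tsum {F : ℕ → ℝ × ℝ → ℍ[ℝ]} (hF : ∀ n, Continuous (F n))
    (hs : ∀ x : ℝ × ℝ, x.1 ∈ Ioo (0:ℝ) 1 → Summable fun n => F n x) :
    AEStronglyMeasurable (fun x => ∑' n, F n x) mupol := by
  refine aestronglyMeasurable_of_tendsto_ae (u := atTop) (f := fun N a => ∑ i ∈ Finset.range N, F i a)
      (fun N => ?_) ?_
  · exact (continuous_finsetSum _ fun i _ => hF i).aestronglyMeasurable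
  · exact ae_mupol fun x hx => (hs x hx).hasSum.tendsto_sum_nat

lemma summable_diag {a b : ℕ → ℝ} (ha : Summable a) (hb : Summable b) (ha0 : ∀ n, 0 ≤ a n)
    (hb0 : ∀ n, 0 ≤ b n) : Summable fun n => a n * b n := by
  have hinj : Function.Injective fun n : ℕ => (n, n) := fun a b h => by simpa using h
  exact (ha.mul_of_nonneg hb ha0 hb0).comp_injective hinj

lemma polar_change (F G : ℝ × ℝ → ℍ[ℝ])
    (h : ∀ r ∈ Ioo (0:ℝ) 1, ∀ θ, r • F (r * Real.cos θ, r * Real.sin θ) = G (r, θ)) :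
    ∫ p in {p : ℝ × ℝ | p.1 ^ 2 + p.2 ^ 2 < 1}, F p = ∫ x, G x ∂mupol := by
  have hS : MeasurableSet {p : ℝ × ℝ | p.1 ^ 2 + p.2 ^ 2 < 1} :=
    measurableSet_lt (by fun_prop) (by fun_prop)
  have hT : MeasurableSet (Iio (1:ℝ) ×ˢ (univ : Set ℝ)) := measurableSet_Iio.prod MeasurableSet.univ
  rw [← integral_indicator hS, ← integral_comp_polarCoord_symm, mupol_eq]
  have : polarCoord.target ∩ (Iio (1:ℝ) ×ˢ (univ : Set ℝ)) = Ioo (0:ℝ) 1 ×ˢ Ioo (-π) π := by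
    ext x; simp [polarCoord]; tauto
  rw [← this, ← setIntegral_indicator hT]
  refine setIntegral_congr_fun polarCoord.open_target.measurableSet ?_
  rintro ⟨r, θ⟩ hx
  have hr : 0 < r := by simp [polarCoord] at hx; exact hx.1
  have e : (r * Real.cos θ) ^ 2 + (r * Real.sin θ) ^ 2 = r ^ 2 := by
    have := Real.sin_sq_add_cos_sq θ
    linear_combination r ^ 2 * this
  simp only [polarCoord_symm_apply]
  by_cases h1 : r < 1
  · rw [indicator_of_mem, indicator_of_mem, h r ⟨hr, h1⟩]
    · simp [h1]
    · simp only [mem_ofPred_eq]; rw [e]; nlinarith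
  · rw [indicator_of_notMem, indicator_of_notMem, smul_zero]
    · simp [h1]
    · simp only [mem_ofPred_eq]; rw [e]; nlinarith

lemma summable_pol (I : ℍ[ℝ]) (hI : I ^ 2 = -1) {C : ℕ → ℍ[ℝ]} {r : ℝ} (hr : 0 ≤ r) (θ : ℝ)
    (hC : Summable fun n => ‖C n‖ * r ^ n) : Summable fun n => ‖pol I r θ ^ n * C n‖ := by
  simpa [norm_pol I hI hr, mul_comm] using hC

lemma integrable_sq {β η : ℝ} (hβ : 0 < β) (hη : 0 < η) (I : ℍ[ℝ]) (hI : I ^ 2 = -1)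
    (c : ℕ → ℍ[ℝ]) (hc : Summable fun n : ℕ => gamCoef β η n * ‖c n‖ ^ 2) :
    Integrable (fun x : ℝ × ℝ => wr β η 0 x.1 * ‖∑' n, pol I x.1 x.2 ^ n * c n‖ ^ 2) mupol := by
  have hs : ∀ r ∈ Ioo (0:ℝ) 1, Summable fun n => ‖c n‖ * r ^ n := fun r hr =>
    summable_coef hβ hη hr.1.le hr.2 hc
  have hwm : AEStronglyMeasurable (fun x : ℝ × ℝ => wr β η 0 x.1) mupol :=
    (wr_integral hβ hη 0).1.1.comp_fst
  have hfm : AEStronglyMeasurable (fun x : ℝ × ℝ => ∑' n, pol I x.1 x.2 ^ n * c n) mupol := by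
    refine meas_tsum (fun n => ((continuous_pol I).pow n).mul continuous_const) fun x hx => ?_
    exact (summable_pol I hI hx.1.le x.2 (hs x.1 hx)).of_norm
  have hm := hwm.mul (hfm.norm.pow 2)
  have hrad := (radial hβ hη (fun n => (2 * π) • (star (c n) * c n)) (by
      refine (summable_congr fun n => ?_).mpr (hc.mul_left (2 * π))
      rw [norm_smul, Real.norm_of_nonneg (by positivity), norm_mul, Quaternion.norm_star]
      ring) (by
      intro r hr
      have := summable_diag (hs r hr) (hs r hr) (fun n => by have := hr.1; positivity) (fun n => by have := hr.1; positivity)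
      refine (summable_congr fun n => ?_).mpr (this.mul_left (2 * π))
      rw [norm_smul, Real.norm_of_nonneg (by positivity), norm_mul, Quaternion.norm_star]
      ring)).1.norm
  refine (integrable_prod_iff hm).mpr ⟨?_, ?_⟩
  · have h1 := hm.prodMk_left
    filter_upwards [h1, ae_restrict_mem measurableSet_Ioo] with r hr1 hr
    refine Integrable.of_bound hr1 (wr β η 0 r * (∑' n, ‖c n‖ * r ^ n) ^ 2) (Eventually.of_forall fun θ => ?_)
    have hw := wr_nonneg β η 0 hr
    simp only [Pi.mul_apply, Pi.pow_apply]
    rw [Real.norm_of_nonneg (by positivity)]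
    gcongr
    refine (norm_tsum_le_tsum_norm (summable_pol I hI hr.1.le θ (hs r hr))).trans (le_of_eq ?_)
    congr 1; ext n
    simp [norm_pol I hI hr.1.le, mul_comm]
  · refine IntegrableOn.congr_fun hrad (fun r hr => ?_) measurableSet_Ioo
    have hw := wr_nonneg β η 0 hr
    have hcl := circle_lemma I hI hr.1.le (fun n => star (c n)) c (by simpa using hs r hr) (hs r hr)
    have hstar : ∀ θ, (∑' k, star (c k) * star (pol I r θ) ^ k) = star (∑' n, pol I r θ ^ n * c n) := by
      intro θ; rw [tsum_star]; simp
    simp only [hstar, star_mul_self_smul] at hcl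
    rw [integral_smul_const] at hcl
    have hI0 : 0 ≤ ∫ θ in Ioo (-π) π, ‖∑' n, pol I r θ ^ n * c n‖ ^ 2 := integral_nonneg fun _ => by positivity
    have e1 : ∑' n, wr β η n r • (2 * π) • (‖c n‖ ^ 2 • (1 : ℍ[ℝ])) =
        wr β η 0 r • ∑' n, (2 * π * r ^ (2 * n)) • (‖c n‖ ^ 2 • (1 : ℍ[ℝ])) := by
      rw [← tsum_const_smul'']
      congr 1; ext1 n
      rw [smul_smul, smul_smul _ (2 * π * r ^ (2 * n))]
      congr 1
      unfold wr
      ring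
    simp only [star_mul_self_smul]
    rw [e1, ← hcl, norm_smul, norm_smul, Real.norm_of_nonneg hw, Real.norm_of_nonneg hI0, norm_one, mul_one,
      ← integral_const_mul]
    congr 1; ext1 θ
    simp only [Pi.mul_apply, Pi.pow_apply]
    rw [Real.norm_of_nonneg (by positivity)]

/-- Reproducing property of the kernel `K_{β,η}` (Proposition 2.1). -/
theorem stmt_1 (β η : ℝ) (hβ : 0 < β) (hη : 0 < η) (I : ℍ[ℝ]) (hI : I ^ 2 = -1)
    (c : ℕ → ℍ[ℝ]) (hc : Summable fun n : ℕ => gamCoef β η n * ‖c n‖ ^ 2)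
    (f : ℍ[ℝ] → ℍ[ℝ]) (hf : ∀ q : ℍ[ℝ], ‖q‖ < 1 → f q = ∑' n : ℕ, q ^ n * c n)
    (q : ℍ[ℝ]) (hq : ‖q‖ < 1) :
    (∫ p in {p : ℝ × ℝ | p.1 ^ 2 + p.2 ^ 2 < 1},
      weightBeta β η (p.1 ^ 2 + p.2 ^ 2) •
        (star (Kker β η ((p.1 : ℍ[ℝ]) + p.2 • I) q) * f ((p.1 : ℍ[ℝ]) + p.2 • I))) = f q := by
  have hπ := pi_pos
  set A : ℕ → ℍ[ℝ] := fun k => (π * gamCoef β η k)⁻¹ • q ^ k with hAdef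
  have hAn : ∀ k, ‖A k‖ = π⁻¹ * ((gamCoef β η k)⁻¹ * ‖q‖ ^ k) := by
    intro k
    have := gamCoef_pos hβ hη k
    rw [hAdef]; simp only
    rw [norm_smul, norm_pow, Real.norm_of_nonneg (by positivity), mul_inv]
    ring
  have hA1 : Summable fun k => ‖A k‖ := by
    simp_rw [hAn]
    exact (summable_inv_gam hβ hη (norm_nonneg q) hq).mul_left _
  have hA : ∀ r ∈ Ioo (0:ℝ) 1, Summable fun k => ‖A k‖ * r ^ k := by
    intro r hr
    refine Summable.of_nonneg_of_le (fun k => ?_) (fun k => ?_) hA1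
    · have := hr.1; positivity
    · exact mul_le_of_le_one_right (norm_nonneg _) (pow_le_one₀ hr.1.le hr.2.le)
  have hs : ∀ r ∈ Ioo (0:ℝ) 1, Summable fun n => ‖c n‖ * r ^ n := fun r hr =>
    summable_coef hβ hη hr.1.le hr.2 hc
  have hK : ∀ p : ℍ[ℝ], star (Kker β η p q) = ∑' k, A k * star p ^ k := by
    intro p
    unfold Kker
    rw [Quaternion.star_smul, tsum_star, ← tsum_const_smul'']
    congr 1; ext1 k
    rw [Quaternion.star_smul, smul_smul, coef_eq hβ hη]
    simp [hAdef]
  have hsA : ∀ r ∈ Ioo (0:ℝ) 1, ∀ θ, Summable fun k => ‖A k * star (pol I r θ) ^ k‖ := by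
    intro r hr θ; simpa [norm_pol I hI hr.1.le] using hA r hr
  set G : ℝ × ℝ → ℍ[ℝ] := fun x => wr β η 0 x.1 •
    ((∑' k, A k * star (pol I x.1 x.2) ^ k) * ∑' n, pol I x.1 x.2 ^ n * c n) with hG
  rw [polar_change _ G]
  swap
  · intro r hr θ
    have e : (r * Real.cos θ) ^ 2 + (r * Real.sin θ) ^ 2 = r ^ 2 := by
      have := Real.sin_sq_add_cos_sq θ
      linear_combination r ^ 2 * this
    have hp : (((r * Real.cos θ : ℝ)) : ℍ[ℝ]) + (r * Real.sin θ) • I = pol I r θ := rfl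
    simp only [hG]
    rw [e, hp, hK, hf _ (by rw [norm_pol I hI hr.1.le]; exact hr.2), smul_smul]
    simp [wr]
  have hwi : Integrable (fun x : ℝ × ℝ => wr β η 0 x.1) mupol :=
    Integrable.comp_fst (wr_integral hβ hη 0).1 _
  have hGi : Integrable G mupol := by
    have hfm : AEStronglyMeasurable (fun x : ℝ × ℝ => ∑' n, pol I x.1 x.2 ^ n * c n) mupol := by
      refine meas_tsum (fun n => ((continuous_pol I).pow n).mul continuous_const) fun x hx => ?_
      exact (summable_pol I hI hx.1.le x.2 (hs x.1 hx)).of_norm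
    have hkm : AEStronglyMeasurable (fun x : ℝ × ℝ => ∑' k, A k * star (pol I x.1 x.2) ^ k) mupol := by
      refine meas_tsum (fun n => continuous_const.mul ((continuous_star.comp (continuous_pol I)).pow n)) fun x hx => ?_
      exact (hsA x.1 hx x.2).of_norm
    refine Integrable.mono' ((hwi.add (integrable_sq hβ hη I hI c hc)).const_mul (∑' k, ‖A k‖))
      (hwi.1.smul (hkm.mul hfm)) (ae_mupol fun x hx => ?_)
    have hw := wr_nonneg β η 0 hx
    have hM : ‖∑' k, A k * star (pol I x.1 x.2) ^ k‖ ≤ ∑' k, ‖A k‖ := by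
      refine (norm_tsum_le_tsum_norm (hsA x.1 hx x.2)).trans ?_
      refine (hsA x.1 hx x.2).tsum_le_tsum (fun k => ?_) hA1
      rw [norm_mul, norm_pow, Quaternion.norm_star, norm_pol I hI hx.1.le]
      exact mul_le_of_le_one_right (norm_nonneg _) (pow_le_one₀ hx.1.le hx.2.le)
    simp only [hG, Pi.add_apply]
    rw [norm_smul, norm_mul, Real.norm_of_nonneg hw]
    set y := ‖∑' n, pol I x.1 x.2 ^ n * c n‖
    have hy : y ≤ 1 + y ^ 2 := by nlinarith [sq_nonneg (y - 1)]
    have hM0 : 0 ≤ ∑' k, ‖A k‖ := tsum_nonneg fun k => norm_nonneg _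
    calc _ ≤ wr β η 0 x.1 * ((∑' k, ‖A k‖) * (1 + y ^ 2)) := by gcongr
      _ = _ := by ring
  rw [mupol] at hGi ⊢
  rw [integral_prod _ hGi]
  have hrad := (radial hβ hη (fun n => (2 * π) • (A n * c n)) (by
      have hqs := summable_coef hβ hη (norm_nonneg q) hq hc
      refine (summable_congr fun n => ?_).mpr (hqs.mul_left 2)
      have := gamCoef_pos hβ hη n
      rw [norm_smul, Real.norm_of_nonneg (by positivity), norm_mul, hAn]
      field_simp) (by
      intro r hr
      have := summable_diag (hA r hr) (hs r hr) (fun n => by have := hr.1; positivity) (fun n => by have := hr.1; positivity)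
      refine (summable_congr fun n => ?_).mpr (this.mul_left (2 * π))
      rw [norm_smul, Real.norm_of_nonneg (by positivity), norm_mul]
      ring)).2
  have hin : ∀ r ∈ Ioo (0:ℝ) 1, ∫ θ in Ioo (-π) π, G (r, θ) = ∑' n, wr β η n r • (2 * π) • (A n * c n) := by
    intro r hr
    simp only [hG]
    rw [integral_smul, circle_lemma I hI hr.1.le A c (hA r hr) (hs r hr), ← tsum_const_smul'']
    congr 1; ext1 n
    rw [smul_smul, smul_smul]
    congr 1
    unfold wr
    ring
  rw [setIntegral_congr_fun measurableSet_Ioo hin, hrad, hf q hq]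
  congr 1; ext1 n
  have := gamCoef_pos hβ hη n
  simp only [hAdef]
  rw [smul_mul_assoc, smul_smul, smul_smul]
  rw [show gamCoef β η n / 2 * (2 * π) * (π * gamCoef β η n)⁻¹ = 1 by field_simp, one_smul]
end

section
/- First identity of Proposition KerKer (equation (13)): let α > -1, β, η > 0, x, y > 0, fix I ∈ ℍ with I² = -1, and let q ∈ ℍ with ‖q‖ < 1. Then ∫∫_{{u²+v²<1}} conj(K_{β,η}(u+vI, q)) · R_{u+vI}^α(x,y) · ω_{β,η}(u²+v²) du dv = R_q^α(x,y). -/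
open MeasureTheory Real Quaternion

/-- Generalized Laguerre polynomial `L_n^{(α)}(x)`. -/
noncomputable def genLaguerre (α : ℝ) (n : ℕ) (x : ℝ) : ℝ :=
  ∑ k ∈ Finset.range (n + 1),
    ((-1 : ℝ) ^ k / (Nat.factorial k)) *
      (Real.Gamma (n + α + 1) / (Real.Gamma (k + α + 1) * (Nat.factorial (n - k)))) * x ^ k

/-- Normalized Laguerre function `φ_n^α(x)`. -/
noncomputable def lagPhi (α : ℝ) (n : ℕ) (x : ℝ) : ℝ :=
  Real.sqrt ((Nat.factorial n : ℝ) / Real.Gamma (n + α + 1)) * genLaguerre α n x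

/-- The kernel `R_q^α(x,y) = Σ_n qⁿ φ_n^α(x) φ_n^α(y)`. -/
noncomputable def Rker (α : ℝ) (q : ℍ[ℝ]) (x y : ℝ) : ℍ[ℝ] :=
  ∑' n : ℕ, (lagPhi α n x * lagPhi α n y) • q ^ n

namespace KK
open Filter Topology

lemma ev_quad (c b a : ℝ) (hc : 0 < c) : ∀ᶠ m : ℕ in atTop, 0 ≤ c * (m:ℝ)^2 + b * m + a := by
  have h := tendsto_natCast_atTop_atTop (R := ℝ)
  filter_upwards [h.eventually_ge_atTop ((|b| + |a|) / c), h.eventually_ge_atTop 1] with m h1 h2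
  rw [div_le_iff₀ hc] at h1
  have hb := neg_abs_le b
  have ha := neg_abs_le a
  have ha' := abs_nonneg a
  nlinarith [mul_le_mul_of_nonneg_left h1 (by linarith : (0:ℝ) ≤ m)]

lemma form_nonneg (c1 c2 K b m D M : ℝ) (h2 : 0 < c2) (hb : |b| ≤ K)
    (hm : K ^ 2 ≤ 4 * c1 * c2 * m) : 0 ≤ c1 * m * D ^ 2 + b * (D * M) + c2 * M ^ 2 := by
  have hb2 : b ^ 2 ≤ K ^ 2 := sq_le_sq' (by linarith [neg_abs_le b]) (by linarith [le_abs_self b])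
  have : 0 ≤ 4 * c2 * (c1 * m * D ^ 2 + b * (D * M) + c2 * M ^ 2) := by
    nlinarith [sq_nonneg (2 * c2 * M + b * D), mul_nonneg (sub_nonneg.2 (hb2.trans hm)) (sq_nonneg D)]
  exact nonneg_of_mul_nonneg_right (by linarith) (by positivity : 0 < 4 * c2)

/-- energy -/
noncomputable def en (α x m D M : ℝ) : ℝ := m * D ^ 2 + (1/2 + α - x) * (D * M) + x * M ^ 2

lemma en_lower (α x : ℝ) (hx : 0 < x) : ∀ᶠ m : ℕ in atTop, ∀ D M : ℝ,
    x / 2 * M ^ 2 ≤ en α x m D M := by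
  have h := tendsto_natCast_atTop_atTop (R := ℝ)
  filter_upwards [h.eventually_ge_atTop (|1/2 + α - x| ^ 2 / (4 * 1 * (x/2)))] with m h1 D M
  rw [div_le_iff₀ (by positivity)] at h1
  have := form_nonneg 1 (x/2) _ (1/2 + α - x) m D M (by positivity) le_rfl (by linarith)
  unfold en; linarith

lemma en_step (α x τ : ℝ) (hα : -1 < α) (hx : 0 < x) (hτ : τ < 1/2) :
    ∀ᶠ m : ℕ in atTop, ∀ D M : ℝ,
      (m + 1 + α) / (m + 1) * en α x (m + 1) ((m * D - x * M) / (m + 1 + α))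
        (M + (m * D - x * M) / (m + 1 + α)) ≤ (1 - τ / m) * en α x m D M := by
  have h := tendsto_natCast_atTop_atTop (R := ℝ)
  obtain ⟨l, hl⟩ : ∃ l, l = 1/2 + α - x := ⟨_, rfl⟩
  have hε : 0 < (1/2 - τ) / 2 := by linarith
  obtain ⟨K, hK⟩ : ∃ K, K = |l * ((1 - τ) + 2 * x) - 2 * x * (α - x)| + |l * ((1+α) * (1 - τ) - τ)| + |l * ((1+α) * τ)| := ⟨_, rfl⟩
  filter_upwards [ev_quad _ (1 + α - 2 * τ - τ * α) (- (τ * (1 + α))) hε,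
    ev_quad _ (-(τ+α)*(1+α) - τ - (x - l*(1+α)+l*x-2*x*(1+α)+x^2)) (- (τ * (1 + α))) hε,
    h.eventually_ge_atTop 1,
    h.eventually_ge_atTop (K ^ 2 / (4 * ((1/2 - τ) / 2) * (x * ((1/2 - τ) / 2))))] with m hA hC h1 h2 D M
  rw [div_le_iff₀ (by positivity)] at h2
  have hm : (0:ℝ) < m := by linarith
  have hs : (0:ℝ) < m + 1 + α := by linarith
  set s : ℝ := m + 1 + α with hsd
  have hb : |(l * (s * ((1-τ)*m - τ) + 2*x*m^2) - 2*x*(α-x)*m^2) / m^2| ≤ K := by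
    rw [abs_div, abs_of_pos (by positivity : (0:ℝ) < m^2), div_le_iff₀ (by positivity), hK]
    have e : l * (s * ((1-τ)*m - τ) + 2*x*m^2) - 2*x*(α-x)*m^2 =
      (l * ((1 - τ) + 2 * x) - 2 * x * (α - x)) * m^2 + (l * ((1+α) * (1 - τ) - τ)) * m
        + -(l * ((1+α) * τ)) := by rw [hsd]; ring
    rw [e]
    have h3 : (m:ℝ) ≤ m^2 := by nlinarith
    have h4 : (1:ℝ) ≤ m^2 := by nlinarith
    refine (abs_add_three _ _ _).trans ?_
    rw [abs_mul, abs_mul, abs_neg, abs_of_pos hm, abs_of_pos (by positivity : (0:ℝ) < m^2)]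
    nlinarith [mul_le_mul_of_nonneg_left h3 (abs_nonneg (l * ((1+α) * (1 - τ) - τ))),
      mul_le_mul_of_nonneg_left h4 (abs_nonneg (l * ((1+α) * τ)))]
  have key := form_nonneg ((1/2 - τ)/2) (x * ((1/2 - τ)/2)) K _ m D M (by positivity) hb (by linarith)
  have key2 := mul_nonneg (sq_nonneg (m:ℝ)) key
  have kA := mul_nonneg (mul_nonneg hm.le hA) (sq_nonneg D)
  have kC := mul_nonneg (mul_nonneg hx.le hC) (sq_nonneg M)
  have main : (0:ℝ) ≤ (m - τ) * (m + 1) * s * en α x m D M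
      - m * ((m+1) * (m*D-x*M)^2 + l * ((m*D-x*M)*(s*M+(m*D-x*M))) + x * (s*M+(m*D-x*M))^2) := by
    refine (add_nonneg (add_nonneg key2 kA) kC).trans_eq ?_
    unfold en
    rw [← hl]
    field_simp
    rw [hsd, hl]
    ring
  have e1 : (s / (m+1) * en α x (m + 1) ((m * D - x * M) / s) (M + (m * D - x * M) / s))
     = (m * ((m+1) * (m*D-x*M)^2 + l * ((m*D-x*M)*(s*M+(m*D-x*M))) + x * (s*M+(m*D-x*M))^2)) / (m * (m+1) * s) := by
    unfold en
    rw [← hl]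
    field_simp
  have e2 : (1 - τ / m) * en α x m D M = ((m - τ) * (m + 1) * s * en α x m D M) / (m * (m+1) * s) := by
    field_simp
  rw [e1, e2]
  exact div_le_div_of_nonneg_right (by linarith) (by positivity)

/-- binomial form of the Laguerre polynomial -/
noncomputable def A (n : ℕ) (t : ℕ → ℝ) : ℝ := ∑ k ∈ Finset.range (n + 1), (n.choose k : ℝ) * t k

lemma A_succ (n : ℕ) (t : ℕ → ℝ) : A (n+1) t = A n t + A n (fun k => t (k+1)) := by
  unfold A
  rw [Finset.sum_range_succ']
  simp only [Nat.choose_succ_succ, Nat.cast_add, add_mul, Finset.sum_add_distrib]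
  rw [Finset.sum_range_succ (fun k => ((n.choose (k+1) : ℕ) : ℝ) * t (k+1))]
  rw [Finset.sum_range_succ' (fun k => ((n.choose k : ℕ) : ℝ) * t k)]
  simp
  ring

lemma A_deriv (n : ℕ) (t : ℕ → ℝ) : ((n:ℝ)+1) * (A (n+1) t - A n t) = A (n+1) (fun k => k * t k) := by
  rw [A_succ, add_sub_cancel_left]
  unfold A
  rw [Finset.sum_range_succ' _ (n+1), Finset.mul_sum]
  simp only [CharP.cast_eq_zero, zero_mul, mul_zero, add_zero]
  refine Finset.sum_congr rfl fun k _ => ?_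
  have := Nat.add_one_mul_choose_eq n k
  have h2 : ((n:ℝ)+1) * n.choose k = (n+1).choose (k+1) * (k+1) := by exact_mod_cast this
  push_cast
  rw [← mul_assoc, h2]; ring

noncomputable def tt (α x : ℝ) (k : ℕ) : ℝ := (-x)^k / Real.Gamma (k + α + 1)

lemma tt_succ (α x : ℝ) (hα : -1 < α) (k : ℕ) : (k + α + 1) * tt α x (k+1) = - x * tt α x k := by
  have h : 0 < (k:ℝ) + α + 1 := by have := Nat.cast_nonneg (α := ℝ) k; linarith
  unfold tt
  have e : ((k+1:ℕ):ℝ) + α + 1 = (k + α + 1) + 1 := by push_cast; ring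
  rw [e, Real.Gamma_add_one h.ne', pow_succ]
  have := (Real.Gamma_pos_of_pos h).ne'
  field_simp

noncomputable def MM (α x : ℝ) (n : ℕ) : ℝ := A n (tt α x)

lemma MM_rec (α x : ℝ) (hα : -1 < α) (n : ℕ) :
    ((n:ℝ) + 1 + 1 + α) * (MM α x (n+2) - MM α x (n+1)) =
      (n+1) * (MM α x (n+1) - MM α x n) - x * MM α x (n+1) := by
  unfold MM
  have h1 := A_succ (n+1) (tt α x)
  have h2 := A_succ n (tt α x)
  have h3 := A_deriv n (fun k => tt α x (k+1))
  have h4 : (-x) * A (n+1) (tt α x) = A (n+1) (fun k => k * tt α x (k+1)) + (α+1) * A (n+1) (fun k => tt α x (k+1)) := by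
    unfold A
    rw [Finset.mul_sum, Finset.mul_sum, ← Finset.sum_add_distrib]
    refine Finset.sum_congr rfl fun k _ => ?_
    have := tt_succ α x hα k
    linear_combination (-((n+1).choose k : ℝ)) * this
  rw [h1, h2] at *
  linear_combination h3 - h4

noncomputable def hh (α : ℝ) (n : ℕ) : ℝ := Real.Gamma (n + α + 1) / n.factorial

lemma hh_pos (α : ℝ) (hα : -1 < α) (n : ℕ) : 0 < hh α n := by
  have h : 0 < (n:ℝ) + α + 1 := by have := Nat.cast_nonneg (α := ℝ) n; linarith
  unfold hh
  have := Real.Gamma_pos_of_pos h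
  positivity

lemma hh_succ (α : ℝ) (hα : -1 < α) (n : ℕ) : hh α (n+1) = hh α n * ((n + 1 + α) / (n + 1)) := by
  have h : 0 < (n:ℝ) + α + 1 := by have := Nat.cast_nonneg (α := ℝ) n; linarith
  unfold hh
  have e : ((n+1:ℕ):ℝ) + α + 1 = (n + α + 1) + 1 := by push_cast; ring
  rw [e, Real.Gamma_add_one h.ne', Nat.factorial_succ]
  push_cast
  field_simp
  ring

lemma genLaguerre_eq (α x : ℝ) (n : ℕ) : genLaguerre α n x = hh α n * MM α x n := by
  unfold genLaguerre hh MM A tt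
  rw [Finset.mul_sum]
  refine Finset.sum_congr rfl fun k hk => ?_
  have hk' : k ≤ n := by simpa [Nat.lt_succ_iff] using hk
  rw [Nat.cast_choose ℝ hk', neg_pow x]
  have := (Nat.factorial_pos n).ne'
  have := (Nat.factorial_pos k).ne'
  field_simp

lemma lagPhi_sq (α x : ℝ) (hα : -1 < α) (n : ℕ) : lagPhi α n x ^ 2 = hh α n * MM α x n ^ 2 := by
  have h := hh_pos α hα n
  have e : (n.factorial : ℝ) / Real.Gamma (n + α + 1) = (hh α n)⁻¹ := by unfold hh; rw [inv_div]
  unfold lagPhi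
  rw [genLaguerre_eq, e, mul_pow, Real.sq_sqrt (by positivity)]
  field_simp

/-- normalised energy, index `m = n+1` -/
noncomputable def ff (α x : ℝ) (n : ℕ) : ℝ := hh α n * en α x n (MM α x n - MM α x (n-1)) (MM α x n)

lemma ff_step (α x τ : ℝ) (hα : -1 < α) (hx : 0 < x) (hτ : τ < 1/2) :
    ∀ᶠ m : ℕ in atTop, ff α x (m+1) ≤ (1 - τ / m) * ff α x m := by
  filter_upwards [en_step α x τ hα hx hτ, eventually_ge_atTop 1] with m hm h1
  obtain ⟨n, rfl⟩ : ∃ n, m = n + 1 := ⟨m-1, by omega⟩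
  have h := hm (MM α x (n+1) - MM α x n) (MM α x (n+1))
  have hs : (0:ℝ) < n + 1 + 1 + α := by have := Nat.cast_nonneg (α := ℝ) n; linarith
  have r := MM_rec α x hα n
  unfold ff
  rw [hh_succ α hα]
  simp only [Nat.add_sub_cancel] at *
  push_cast at *
  have e : ((n + 1) * (MM α x (n+1) - MM α x n) - x * MM α x (n+1)) / (n + 1 + 1 + α) = MM α x (n+1+1) - MM α x (n+1) := by
    rw [div_eq_iff hs.ne', ← r]; ring
  rw [e] at h
  have h' := mul_le_mul_of_nonneg_left h (hh_pos α hα (n+1)).le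
  rw [add_sub_cancel] at h'
  linarith

lemma ff_lower (α x : ℝ) (hα : -1 < α) (hx : 0 < x) :
    ∀ᶠ m : ℕ in atTop, x / 2 * lagPhi α m x ^ 2 ≤ ff α x m := by
  filter_upwards [en_lower α x hx] with m hm
  rw [lagPhi_sq α x hα]
  unfold ff
  have := mul_le_mul_of_nonneg_left (hm (MM α x m - MM α x (m-1)) (MM α x m)) (hh_pos α hα m).le
  linarith

lemma raabe (u : ℕ → ℝ) (δ : ℝ) (hδ : 0 < δ) (hu : ∀ᶠ n in atTop, 0 ≤ u n)
    (h : ∀ᶠ n : ℕ in atTop, n * u (n+1) ≤ (n - 1 - δ) * u n) : Summable u := by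
  obtain ⟨N, hN⟩ := eventually_atTop.1 (hu.and h)
  rw [← summable_nat_add_iff (N + 1)]
  have key : ∀ k, δ * ∑ i ∈ Finset.range k, u (i + (N+1)) + ((k + N : ℕ):ℝ) * u (k + (N + 1)) ≤ N * u (N+1) := by
    intro k
    induction k with
    | zero => simp
    | succ k ih =>
      rw [Finset.sum_range_succ]
      have := (hN (k + (N+1)) (by omega)).2
      have e : k + 1 + (N+1) = k + (N+1) + 1 := by ring
      rw [e]
      push_cast at *
      linarith
  refine summable_of_sum_range_le (c := N * u (N+1) / δ) (fun n => (hN _ (by omega)).1) fun k => ?_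
  rw [le_div_iff₀ hδ]
  have h2 : 0 ≤ ((k + N : ℕ):ℝ) * u (k + (N + 1)) := mul_nonneg (by positivity) (hN _ (by omega)).1
  linarith [key k]

noncomputable def gam (β η : ℝ) (n : ℕ) : ℝ := Real.Gamma η * Real.Gamma (β + n) / Real.Gamma (β + η + n)

lemma gam_pos (β η : ℝ) (hβ : 0 < β) (hη : 0 < η) (n : ℕ) : 0 < gam β η n := by
  unfold gam
  have h1 := Real.Gamma_pos_of_pos hη
  have h2 := Real.Gamma_pos_of_pos (by positivity : 0 < β + n)
  have h3 := Real.Gamma_pos_of_pos (by positivity : 0 < β + η + n)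
  positivity

lemma gam_succ (β η : ℝ) (hβ : 0 < β) (hη : 0 < η) (n : ℕ) :
    gam β η (n+1) = gam β η n * ((β + n) / (β + η + n)) := by
  unfold gam
  have h2 : 0 < β + n := by positivity
  have h3 : 0 < β + η + n := by positivity
  push_cast
  rw [← add_assoc, ← add_assoc, Real.Gamma_add_one h2.ne', Real.Gamma_add_one h3.ne']
  have := Real.Gamma_pos_of_pos h3
  field_simp

noncomputable def aa (α x y : ℝ) (n : ℕ) : ℝ := lagPhi α n x * lagPhi α n y

lemma aa_sq_summable (α β η x y : ℝ) (hα : -1 < α) (hβ : 0 < β) (hη : 0 < η) (hx : 0 < x) (hy : 0 < y) :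
    Summable fun n => aa α x y n ^ 2 * gam β η n := by
  set τ : ℝ := 1/2 - η/8 with hτd
  have hτ : τ < 1/2 := by linarith
  have hpos : ∀ᶠ n in atTop, 0 ≤ ff α x n * ff α y n * gam β η n := by
    filter_upwards [ff_lower α x hα hx, ff_lower α y hα hy] with n h1 h2
    have h1' : 0 ≤ ff α x n := le_trans (by positivity) h1
    have h2' : 0 ≤ ff α y n := le_trans (by positivity) h2
    have := gam_pos β η hβ hη n
    positivity
  have hu : Summable fun n => ff α x n * ff α y n * gam β η n := by
    refine raabe _ (η/2) (by positivity) hpos ?_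
    filter_upwards [ff_step α x τ hα hx hτ, ff_step α y τ hα hy hτ, ff_lower α x hα hx,
      (eventually_ge_atTop 1), (tendsto_add_atTop_nat 1).eventually (ff_lower α y hα hy), ff_lower α y hα hy, hpos,
      (tendsto_natCast_atTop_atTop (R := ℝ)).eventually_ge_atTop τ,
      ev_quad (η/4) ((-1-η/2)*(β+η) + 2*τ*β - τ^2) (-(τ^2*β)) (by positivity)] with n h1 h2 h3 h4 h5 h6 h7 h8 h9
    have h3' : 0 ≤ ff α x n := le_trans (by positivity) h3
    have h5' : 0 ≤ ff α y (n+1) := le_trans (by positivity) h5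
    have hn : (1:ℝ) ≤ n := by exact_mod_cast h4
    have hn0 : (0:ℝ) < n := by linarith
    have hg := gam_pos β η hβ hη n
    have h8' : 0 ≤ 1 - τ / n := by
      rw [sub_nonneg, div_le_one hn0]; exact h8
    have a1 : ff α x (n+1) * ff α y (n+1) ≤ ((1 - τ/n) * ff α x n) * ((1 - τ/n) * ff α y n) :=
      mul_le_mul h1 h2 h5' (by positivity)
    rw [gam_succ β η hβ hη]
    have hb : 0 < β + η + n := by positivity
    have a2 : n * ((1 - τ/n)^2 * ((β + n) / (β + η + n))) ≤ n - 1 - η/2 := by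
      have : n * ((1 - τ/n)^2 * ((β + n) / (β + η + n))) = (n - τ)^2 * (β + n) / (n * (β + η + n)) := by
        field_simp
      rw [this, div_le_iff₀ (by positivity)]
      rw [← sub_nonneg]
      refine h9.trans_eq ?_
      rw [hτd]; ring
    calc n * (ff α x (n+1) * ff α y (n+1) * (gam β η n * ((β + n) / (β + η + n))))
        ≤ n * (((1 - τ/n) * ff α x n) * ((1 - τ/n) * ff α y n) * (gam β η n * ((β + n) / (β + η + n)))) := by
          gcongr
      _ = (n * ((1 - τ/n)^2 * ((β + n) / (β + η + n)))) * (ff α x n * ff α y n * gam β η n) := by ring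
      _ ≤ _ := by gcongr
  refine summable_of_isBigO_nat (hu.mul_left (4 / (x * y))) ?_
  refine Asymptotics.IsBigO.of_bound 1 ?_
  filter_upwards [ff_lower α x hα hx, ff_lower α y hα hy] with n h1 h2
  have hg := gam_pos β η hβ hη n
  have h := mul_le_mul h1 h2 (by positivity) (le_trans (by positivity) h1)
  have h' := mul_le_mul_of_nonneg_right h hg.le
  have e : aa α x y n ^ 2 * gam β η n = 4 / (x*y) * (x / 2 * lagPhi α n x ^ 2 * (y / 2 * lagPhi α n y ^ 2) * gam β η n) := by
    unfold aa; field_simp; ring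
  rw [Real.norm_of_nonneg (by positivity), one_mul, e]
  refine le_trans ?_ (le_abs_self _)
  gcongr

lemma phi_bdd (α x : ℝ) (hα : -1 < α) (hx : 0 < x) : ∃ C, ∀ᶠ n : ℕ in atTop, lagPhi α n x ^ 2 ≤ C := by
  obtain ⟨N, hN⟩ := eventually_atTop.1 ((ff_step α x 0 hα hx (by norm_num)).and (ff_lower α x hα hx))
  refine ⟨2 / x * ff α x N, eventually_atTop.2 ⟨N, fun n hn => ?_⟩⟩
  have : ff α x n ≤ ff α x N := by
    induction n, hn using Nat.le_induction with
    | base => rfl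
    | succ k hk ih =>
      have := (hN k hk).1
      simp at this
      linarith
  have h2 := (hN n hn).2
  have : lagPhi α n x ^ 2 = 2 / x * (x / 2 * lagPhi α n x ^ 2) := by field_simp
  rw [this]
  gcongr
  linarith

lemma aa_summable (α x y : ℝ) (hα : -1 < α) (hx : 0 < x) (hy : 0 < y) (r : ℝ) (hr : 0 ≤ r) (hr1 : r < 1) :
    Summable fun n => |aa α x y n| * r ^ n := by
  obtain ⟨C, hC⟩ := phi_bdd α x hα hx
  obtain ⟨C', hC'⟩ := phi_bdd α y hα hy
  refine summable_of_isBigO_nat (summable_geometric_of_lt_one hr hr1) ?_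
  refine Asymptotics.IsBigO.of_bound (C + C') ?_
  filter_upwards [hC, hC'] with n h1 h2
  rw [norm_mul, Real.norm_eq_abs, abs_abs]
  gcongr
  unfold aa
  rw [abs_le]
  constructor <;> nlinarith [sq_nonneg (lagPhi α n x + lagPhi α n y), sq_nonneg (lagPhi α n x - lagPhi α n y), sq_nonneg (lagPhi α n x), sq_nonneg (lagPhi α n y)]

open MeasureTheory

lemma beta_int (β η : ℝ) (hβ : 0 < β) (hη : 0 < η) (n : ℕ) :
    ∫ y in Set.Ioi (0:ℝ), (if y < 1 then weightBeta β η y * y ^ n else 0) = gam β η n := by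
  have hb : 0 < β + n := by positivity
  have h1 : ∫ y, ProbabilityTheory.betaPDFReal (β + n) η y = 1 := by
    rw [integral_eq_lintegral_of_nonneg_ae]
    · have := ProbabilityTheory.lintegral_betaPDF_eq_one hb hη
      unfold ProbabilityTheory.betaPDF at this
      rw [this]; simp
    · refine Eventually.of_forall fun y => ?_
      by_cases h : 0 < y ∧ y < 1
      · exact (ProbabilityTheory.betaPDFReal_pos h.1 h.2 hb hη).le
      · simp [ProbabilityTheory.betaPDFReal, h]
    · exact (ProbabilityTheory.stronglyMeasurable_betaPDFReal _ _).aestronglyMeasurable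
  have hB := ProbabilityTheory.beta_pos hb hη
  have h2 : gam β η n = ProbabilityTheory.beta (β + n) η := by
    unfold gam ProbabilityTheory.beta
    rw [mul_comm, add_right_comm]
  have h3 : gam β η n = ∫ y, ProbabilityTheory.beta (β + n) η * ProbabilityTheory.betaPDFReal (β + n) η y := by
    rw [integral_const_mul, h1, mul_one, h2]
  rw [h3, ← integral_indicator measurableSet_Ioi]
  congr 1
  ext y
  unfold ProbabilityTheory.betaPDFReal
  by_cases h0 : 0 < y
  · rw [Set.indicator_of_mem (by exact h0)]
    by_cases h : y < 1
    · simp only [h, h0, and_self, if_true]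
      unfold weightBeta
      have : β + n - 1 = (β - 1) + n := by ring
      rw [this, Real.rpow_add h0, Real.rpow_natCast]
      field_simp
    · simp [h]
  · rw [Set.indicator_of_notMem (by exact h0)]
    simp [h0]

lemma radial_int (β η : ℝ) (hβ : 0 < β) (hη : 0 < η) (n : ℕ) :
    ∫ r in Set.Ioi (0:ℝ), r * (if r ^ 2 < 1 then weightBeta β η (r ^ 2) * (r ^ 2) ^ n else 0) = gam β η n / 2 := by
  have h := integral_comp_rpow_Ioi_of_pos (p := 2)
    (g := fun y : ℝ => if y < 1 then weightBeta β η y * y ^ n else 0) two_pos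
  rw [← beta_int β η hβ hη n, eq_div_iff two_ne_zero, ← h, ← integral_mul_const]
  refine setIntegral_congr_fun measurableSet_Ioi fun r hr => ?_
  have : (2:ℝ) - 1 = 1 := by norm_num
  simp only [Real.rpow_two, this, Real.rpow_one, smul_eq_mul]
  ring

def Dsc : Set (ℝ × ℝ) := {p : ℝ × ℝ | p.1 ^ 2 + p.2 ^ 2 < 1}

lemma meas_Dsc : MeasurableSet Dsc := by
  unfold Dsc
  exact measurableSet_lt (by fun_prop) (by fun_prop)

noncomputable def zz (p : ℝ × ℝ) : ℂ := (p.1 : ℂ) + p.2 * Complex.I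

lemma zz_cont : Continuous zz := by unfold zz; fun_prop

lemma norm_zz_sq (p : ℝ × ℝ) : ‖zz p‖ ^ 2 = p.1 ^ 2 + p.2 ^ 2 := by
  unfold zz
  rw [Complex.norm_add_mul_I, Real.sq_sqrt (by positivity)]

lemma norm_zz_lt (p : ℝ × ℝ) (hp : p ∈ Dsc) : ‖zz p‖ < 1 := by
  have h : p.1 ^ 2 + p.2 ^ 2 < 1 := hp
  rw [← norm_zz_sq] at h
  exact (sq_lt_one_iff₀ (norm_nonneg _)).1 h

noncomputable def ww (β η : ℝ) (p : ℝ × ℝ) : ℝ := weightBeta β η (p.1 ^ 2 + p.2 ^ 2)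

lemma ww_meas (β η : ℝ) : Measurable (ww β η) := by
  unfold ww weightBeta; fun_prop

lemma ww_nonneg (β η : ℝ) (p : ℝ × ℝ) (hp : p ∈ Dsc) : 0 ≤ ww β η p := by
  have h : p.1 ^ 2 + p.2 ^ 2 < 1 := hp
  unfold ww weightBeta
  have : 0 ≤ 1 - (p.1 ^ 2 + p.2 ^ 2) := by linarith
  positivity

lemma ang_int (k n : ℕ) : ∫ θ in Set.Ioo (-π) π, Complex.exp (((n:ℂ) - k) * (θ * Complex.I)) =
    if k = n then (2 * π : ℂ) else 0 := by
  rw [← integral_Ioc_eq_integral_Ioo, ← intervalIntegral.integral_of_le (by linarith [Real.pi_pos])]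
  split_ifs with h
  · subst h
    simp
    ring
  · have hc : ((n:ℂ) - k) * Complex.I ≠ 0 := by
      refine mul_ne_zero (sub_ne_zero.2 ?_) Complex.I_ne_zero
      exact_mod_cast Ne.symm h
    have : ∀ θ : ℝ, Complex.exp (((n:ℂ) - k) * (θ * Complex.I)) = Complex.exp ((((n:ℂ) - k) * Complex.I) * θ) := by
      intro θ; congr 1; ring
    simp_rw [this]
    rw [integral_exp_mul_complex hc]
    have e : Complex.exp (((n:ℂ) - k) * Complex.I * (π:ℝ)) = Complex.exp (((n:ℂ) - k) * Complex.I * ((-π:ℝ):ℂ)) := by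
      rw [Complex.exp_eq_exp_iff_exists_int]
      refine ⟨(n:ℤ) - k, ?_⟩
      push_cast
      ring
    rw [e, sub_self, zero_div]

lemma orth_int (β η : ℝ) (hβ : 0 < β) (hη : 0 < η) (k n : ℕ) :
    ∫ p in Dsc, ww β η p • (star (zz p) ^ k * zz p ^ n) = if k = n then ((π * gam β η n : ℝ) : ℂ) else 0 := by
  rw [← integral_indicator meas_Dsc, ← integral_comp_polarCoord_symm]
  have e : ∀ p ∈ polarCoord.target, p.1 • Dsc.indicator (fun p => ww β η p • (star (zz p) ^ k * zz p ^ n)) (polarCoord.symm p)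
      = ((p.1 * (if p.1 ^ 2 < 1 then weightBeta β η (p.1 ^ 2) * p.1 ^ (k + n) else 0) : ℝ) : ℂ)
        * Complex.exp (((n:ℂ) - k) * (p.2 * Complex.I)) := by
    rintro ⟨r, θ⟩ hp
    have h2 : (r * Real.cos θ) ^ 2 + (r * Real.sin θ) ^ 2 = r ^ 2 := by
      have := Real.sin_sq_add_cos_sq θ
      linear_combination r ^ 2 * this
    have hz : zz (r * Real.cos θ, r * Real.sin θ) = r * Complex.exp (θ * Complex.I) := by
      unfold zz
      rw [Complex.exp_mul_I]; push_cast; ring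
    have hz2 : star (r * Complex.exp (θ * Complex.I)) = r * Complex.exp (-(θ * Complex.I)) := by
      simp [← Complex.exp_conj]
    simp only [polarCoord_symm_apply]
    by_cases h : r ^ 2 < 1
    · rw [Set.indicator_of_mem (by simpa [Dsc, h2] using h), hz, hz2, if_pos h]
      unfold ww
      rw [h2, mul_pow, mul_pow, ← Complex.exp_nat_mul, ← Complex.exp_nat_mul]
      have : Complex.exp (((n:ℂ) - k) * (θ * Complex.I)) = Complex.exp (k * -(θ * Complex.I)) * Complex.exp (n * (θ * Complex.I)) := by
        rw [← Complex.exp_add]; congr 1; ring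
      rw [this]
      simp only [Complex.real_smul]
      push_cast
      ring
    · rw [Set.indicator_of_notMem (by simpa [Dsc, h2] using h), if_neg h]
      simp
  rw [setIntegral_congr_fun polarCoord.open_target.measurableSet e, polarCoord_target, Measure.volume_eq_prod]
  rw [setIntegral_prod_mul (fun r : ℝ => ((r * (if r ^ 2 < 1 then weightBeta β η (r ^ 2) * r ^ (k + n) else 0) : ℝ) : ℂ))
    (fun θ : ℝ => Complex.exp (((n:ℂ) - k) * (θ * Complex.I))), ang_int]
  split_ifs with h
  · subst h
    rw [integral_complex_ofReal]
    have := radial_int β η hβ hη k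
    simp_rw [← pow_mul, two_mul] at this
    rw [this]
    push_cast
    ring
  · simp

lemma ww_integrable (β η : ℝ) (hβ : 0 < β) (hη : 0 < η) : IntegrableOn (ww β η) Dsc := by
  have h := orth_int β η hβ hη 0 0
  simp only [pow_zero, mul_one, if_true] at h
  have hne : ∫ p in Dsc, ww β η p • (1:ℂ) ≠ 0 := by
    rw [h]
    have := gam_pos β η hβ hη 0
    exact_mod_cast (by positivity : π * gam β η 0 ≠ 0)
  have hi : IntegrableOn (fun p => ww β η p • (1:ℂ)) Dsc := by
    by_contra hc
    exact hne (integral_undef hc)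
  have := hi.re
  simpa [IntegrableOn] using this

noncomputable def wn (β η : ℝ) (p : ℝ × ℝ) : NNReal := (ww β η p).toNNReal

lemma wn_meas (β η : ℝ) : Measurable (wn β η) := (ww_meas β η).real_toNNReal

noncomputable def mu (β η : ℝ) : Measure (ℝ × ℝ) := (volume.restrict Dsc).withDensity (fun p => (wn β η p : ENNReal))

lemma mu_finite (β η : ℝ) (hβ : 0 < β) (hη : 0 < η) : IsFiniteMeasure (mu β η) :=
  isFiniteMeasure_withDensity_ofReal (ww_integrable β η hβ hη).2

variable {E : Type*} [NormedAddCommGroup E] [NormedSpace ℝ E]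

lemma wn_smul (β η : ℝ) (f : ℝ × ℝ → E) :
    (fun p => wn β η p • f p) =ᵐ[volume.restrict Dsc] fun p => ww β η p • f p := by
  filter_upwards [ae_restrict_mem meas_Dsc] with p hp
  rw [NNReal.smul_def, wn, Real.coe_toNNReal _ (ww_nonneg β η p hp)]

lemma integral_mu (β η : ℝ) (f : ℝ × ℝ → E) : ∫ p, f p ∂(mu β η) = ∫ p in Dsc, ww β η p • f p := by
  unfold mu
  rw [integral_withDensity_eq_integral_smul (wn_meas β η)]
  exact integral_congr_ae (wn_smul β η f)

lemma ae_mu (β η : ℝ) : ∀ᵐ p ∂(mu β η), p ∈ Dsc :=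
  (withDensity_absolutelyContinuous _ _).ae_le (ae_restrict_mem meas_Dsc)

lemma memLp_pow (β η : ℝ) (hβ : 0 < β) (hη : 0 < η) (n : ℕ) : MemLp (fun p => zz p ^ n) 2 (mu β η) := by
  have := mu_finite β η hβ hη
  refine MemLp.of_bound (zz_cont.pow n).aestronglyMeasurable 1 ?_
  filter_upwards [ae_mu β η] with p hp
  rw [norm_pow]
  exact pow_le_one₀ (norm_nonneg _) (norm_zz_lt p hp).le

lemma main_L2 (β η : ℝ) (hβ : 0 < β) (hη : 0 < η) (a : ℕ → ℝ)
    (hs : ∀ r : ℝ, 0 ≤ r → r < 1 → Summable fun n => |a n| * r ^ n)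
    (ha : Summable fun n => a n ^ 2 * gam β η n) :
    Integrable (fun p => ∑' n, (a n : ℂ) * zz p ^ n) (mu β η) ∧
    ∀ k, ∫ p, star (zz p) ^ k * ∑' n, (a n : ℂ) * zz p ^ n ∂(mu β η) = ((a k * (π * gam β η k) : ℝ) : ℂ) := by
  have := mu_finite β η hβ hη
  set e : ℕ → Lp ℂ 2 (mu β η) := fun n => (memLp_pow β η hβ hη n).toLp with he
  have hcoe : ∀ n, e n =ᵐ[mu β η] fun p => zz p ^ n := fun n => MemLp.coeFn_toLp _
  have hin : ∀ k n, inner ℂ (e k) (e n) = if k = n then ((π * gam β η n : ℝ) : ℂ) else 0 := by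
    intro k n
    rw [← orth_int β η hβ hη, ← integral_mu, L2.inner_def]
    refine integral_congr_ae ?_
    filter_upwards [hcoe k, hcoe n] with p h1 h2
    rw [h1, h2]
    simp [mul_comm]
  have hg : ∀ n, 0 < π * gam β η n := fun n => mul_pos Real.pi_pos (gam_pos β η hβ hη n)
  set c : ℕ → ℝ := fun n => Real.sqrt (π * gam β η n) with hc
  have hcp : ∀ n, 0 < c n := fun n => Real.sqrt_pos.2 (hg n)
  have hc2 : ∀ n, c n ^ 2 = π * gam β η n := fun n => Real.sq_sqrt (hg n).le
  have hv : Orthonormal ℂ (fun n => ((c n : ℂ)⁻¹) • e n) := by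
    rw [orthonormal_iff_ite]
    intro i j
    rw [inner_smul_left, inner_smul_right, hin]
    split_ifs with h
    · subst h
      rw [← hc2]
      have : (c i : ℂ) ≠ 0 := by exact_mod_cast (hcp i).ne'
      simp
      field_simp
    · simp
  have hsum : Summable fun n => (a n : ℂ) • e n := by
    have := (hv.orthogonalFamily.summable_iff_norm_sq_summable (fun n => ((a n * c n : ℝ) : ℂ))).2 (by
      refine (ha.mul_left π).congr fun n => ?_
      rw [Complex.norm_real, Real.norm_eq_abs, sq_abs, mul_pow, hc2]; ring)
    refine this.congr fun n => ?_
    have : (c n : ℂ) ≠ 0 := by exact_mod_cast (hcp n).ne'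
    simp only [LinearIsometry.toSpanSingleton_apply, smul_smul]
    congr 1
    push_cast
    field_simp
  obtain ⟨G, hG⟩ := hsum
  have hGf : (G : ℝ × ℝ → ℂ) =ᵐ[mu β η] fun p => ∑' n, (a n : ℂ) * zz p ^ n := by
    have ht := tendstoInMeasure_of_tendsto_Lp hG.tendsto_sum_nat
    obtain ⟨ns, hns, hae⟩ := ht.exists_seq_tendsto_ae
    have hpart : ∀ N, ((∑ i ∈ Finset.range N, (a i : ℂ) • e i : Lp ℂ 2 (mu β η)) : ℝ × ℝ → ℂ) =ᵐ[mu β η]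
        fun p => ∑ i ∈ Finset.range N, (a i : ℂ) * zz p ^ i := by
      intro N
      induction N with
      | zero => simp only [Finset.range_zero, Finset.sum_empty]; exact Lp.coeFn_zero ℂ 2 (mu β η)
      | succ N ih =>
        rw [Finset.sum_range_succ]
        filter_upwards [Lp.coeFn_add (∑ i ∈ Finset.range N, (a i : ℂ) • e i) ((a N : ℂ) • e N), ih,
          Lp.coeFn_smul (a N : ℂ) (e N), hcoe N] with p h1 h2 h3 h4
        rw [h1, Pi.add_apply, h2, h3, Pi.smul_apply, h4, Finset.sum_range_succ, smul_eq_mul]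
    filter_upwards [hae, ae_all_iff.2 hpart, ae_mu β η] with p h1 h2 h3
    have hsm : Summable fun n => (a n : ℂ) * zz p ^ n := by
      refine Summable.of_norm ((hs ‖zz p‖ (norm_nonneg _) (norm_zz_lt p h3)).congr fun n => ?_)
      simp
    have h4 := hsm.hasSum.tendsto_sum_nat.comp hns.tendsto_atTop
    refine tendsto_nhds_unique h1 (h4.congr fun i => ?_)
    exact (h2 (ns i)).symm
  refine ⟨((Lp.memLp G).integrable (by norm_num)).congr hGf, fun k => ?_⟩
  have h1 : inner ℂ (e k) G = ((a k * (π * gam β η k) : ℝ) : ℂ) := by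
    have h2 := hG.mapL (innerSL ℂ (e k))
    have h3 : HasSum (fun n => innerSL ℂ (e k) ((a n : ℂ) • e n)) ((a k * (π * gam β η k) : ℝ) : ℂ) := by
      convert hasSum_ite_eq k (((a k * (π * gam β η k) : ℝ) : ℂ)) using 2 with n
      rw [innerSL_apply_apply, inner_smul_right, hin]
      by_cases h : k = n
      · subst h; simp
      · simp [h, Ne.symm h]
    exact h2.unique h3
  rw [← h1, L2.inner_def]
  refine integral_congr_ae ?_
  filter_upwards [hcoe k, hGf] with p h1 h2
  rw [h1, h2]
  simp [mul_comm]


lemma star_I (I : ℍ[ℝ]) (hI : I ^ 2 = -1) : star I = -I := by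
  have h : I * I = -1 := by rw [← sq, hI]
  have hre : I.re = 0 := by
    have h0 := congrArg (fun q : ℍ[ℝ] => q.re) h
    have h1 := congrArg (fun q : ℍ[ℝ] => q.imI) h
    have h2 := congrArg (fun q : ℍ[ℝ] => q.imJ) h
    have h3 := congrArg (fun q : ℍ[ℝ] => q.imK) h
    simp at h0 h1 h2 h3
    by_contra hne
    have e1 : I.imI = 0 := by
      have : I.re * I.imI = 0 := by linarith
      simpa [hne] using this
    have e2 : I.imJ = 0 := by
      have : I.re * I.imJ = 0 := by linarith
      simpa [hne] using this
    have e3 : I.imK = 0 := by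
      have : I.re * I.imK = 0 := by linarith
      simpa [hne] using this
    rw [e1, e2, e3] at h0
    nlinarith [sq_nonneg I.re]
  ext <;> simp [hre]

noncomputable def JJ (I : ℍ[ℝ]) (hI : I ^ 2 = -1) : ℂ →ₐ[ℝ] ℍ[ℝ] :=
  Complex.lift ⟨I, by rw [← sq, hI]⟩

lemma JJ_apply (I : ℍ[ℝ]) (hI : I ^ 2 = -1) (z : ℂ) : JJ I hI z = (z.re : ℍ[ℝ]) + z.im • I := by
  simp [JJ, Complex.liftAux_apply]

lemma JJ_zz (I : ℍ[ℝ]) (hI : I ^ 2 = -1) (p : ℝ × ℝ) : JJ I hI (zz p) = (p.1 : ℍ[ℝ]) + p.2 • I := by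
  rw [JJ_apply]; simp [zz]

lemma JJ_star (I : ℍ[ℝ]) (hI : I ^ 2 = -1) (z : ℂ) : star (JJ I hI z) = JJ I hI (star z) := by
  rw [JJ_apply, JJ_apply]
  simp [star_I I hI]

lemma JJ_norm (I : ℍ[ℝ]) (hI : I ^ 2 = -1) (z : ℂ) : ‖JJ I hI z‖ = ‖z‖ := by
  have h : JJ I hI z * star (JJ I hI z) = ((‖z‖ ^ 2 : ℝ) : ℍ[ℝ]) := by
    rw [JJ_star, ← map_mul]
    have : z * star z = ((‖z‖ ^ 2 : ℝ) : ℂ) := by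
      have := Complex.mul_conj' z
      push_cast; exact this
    rw [this, JJ_apply, Complex.ofReal_re, Complex.ofReal_im, zero_smul, add_zero]
  rw [Quaternion.self_mul_star] at h
  have h2 := Quaternion.coe_injective h
  rw [Quaternion.normSq_eq_norm_mul_self, ← sq] at h2
  exact (sq_eq_sq₀ (norm_nonneg _) (norm_nonneg _)).1 h2

noncomputable def JL (I : ℍ[ℝ]) (hI : I ^ 2 = -1) : ℂ →L[ℝ] ℍ[ℝ] := LinearMap.toContinuousLinearMap (JJ I hI).toLinearMap

lemma JL_apply (I : ℍ[ℝ]) (hI : I ^ 2 = -1) (z : ℂ) : JL I hI z = JJ I hI z := rfl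

lemma poch_eq (a : ℝ) (ha : 0 < a) (k : ℕ) : poch a k * Real.Gamma a = Real.Gamma (a + k) := by
  induction k with
  | zero => simp [poch]
  | succ k ih =>
    have h : 0 < a + k := by positivity
    unfold poch at *
    rw [Finset.prod_range_succ]
    push_cast
    rw [← add_assoc, Real.Gamma_add_one h.ne', ← ih]; ring

lemma poch_pos (a : ℝ) (ha : 0 < a) (k : ℕ) : 0 < poch a k :=
  Finset.prod_pos fun i _ => by positivity

noncomputable def cc (β η : ℝ) : ℝ := Real.Gamma (β + η) / (π * Real.Gamma η * Real.Gamma β)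

lemma norm_const (β η : ℝ) (hβ : 0 < β) (hη : 0 < η) (k : ℕ) :
    cc β η * (poch (β + η) k / poch β k) * (π * gam β η k) = 1 := by
  unfold cc gam
  rw [← poch_eq β hβ, ← poch_eq (β + η) (by positivity)]
  have h1 := poch_pos β hβ k
  have h2 := poch_pos (β + η) (by positivity) k
  have h3 := Real.Gamma_pos_of_pos hβ
  have h4 := Real.Gamma_pos_of_pos hη
  have h5 := Real.Gamma_pos_of_pos (by positivity : 0 < β + η)
  have := Real.pi_pos
  field_simp

lemma bb_summable (β η : ℝ) (hβ : 0 < β) (hη : 0 < η) (r : ℝ) (hr : 0 ≤ r) (hr1 : r < 1) :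
    Summable fun k => (poch (β + η) k / poch β k) * r ^ k := by
  rcases hr.eq_or_lt with rfl | hr0
  · refine summable_of_ne_finset_zero (s := {0}) fun k hk => ?_
    simp at hk
    simp [hk]
  have hp : ∀ k, 0 < (poch (β + η) k / poch β k) * r ^ k := fun k => by
    have h1 := poch_pos β hβ k
    have h2 := poch_pos (β + η) (by positivity) k
    positivity
  refine summable_of_ratio_test_tendsto_lt_one hr1 (Eventually.of_forall fun k => (hp k).ne') ?_
  have e : ∀ k : ℕ, ‖(poch (β + η) (k+1) / poch β (k+1)) * r ^ (k+1)‖ / ‖(poch (β + η) k / poch β k) * r ^ k‖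
      = (1 + η / ((k:ℝ) + β)) * r := by
    intro k
    rw [Real.norm_of_nonneg (hp _).le, Real.norm_of_nonneg (hp _).le]
    have h1 := poch_pos β hβ k
    have h2 := poch_pos (β + η) (by positivity) k
    have e1 : poch β (k+1) = poch β k * (β + k) := by unfold poch; rw [Finset.prod_range_succ]
    have e2 : poch (β+η) (k+1) = poch (β+η) k * (β + η + k) := by unfold poch; rw [Finset.prod_range_succ]
    rw [e1, e2, pow_succ]
    have : (0:ℝ) < β + k := by positivity
    have : (0:ℝ) < k + β := by positivity
    field_simp
    ring
  simp_rw [e]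
  have h : Tendsto (fun k : ℕ => (k:ℝ) + β) atTop atTop :=
    tendsto_atTop_add_const_right _ _ tendsto_natCast_atTop_atTop
  simpa using ((h.const_div_atTop η).const_add 1).mul_const r

end KK

/-- First identity of Proposition KerKer (equation (13)). -/
theorem stmt_3 (α β η : ℝ) (hα : -1 < α) (hβ : 0 < β) (hη : 0 < η)
    (x y : ℝ) (hx : 0 < x) (hy : 0 < y) (I : ℍ[ℝ]) (hI : I ^ 2 = -1)
    (q : ℍ[ℝ]) (hq : ‖q‖ < 1) :
    (∫ p in {p : ℝ × ℝ | p.1 ^ 2 + p.2 ^ 2 < 1},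
      weightBeta β η (p.1 ^ 2 + p.2 ^ 2) •
        (star (Kker β η ((p.1 : ℍ[ℝ]) + p.2 • I) q) *
          Rker α ((p.1 : ℍ[ℝ]) + p.2 • I) x y)) = Rker α q x y := by
  open KK in
  set a := aa α x y with ha
  set b : ℕ → ℝ := fun k => poch (β + η) k / poch β k with hb
  have hbp : ∀ k, 0 < b k := fun k => div_pos (poch_pos _ (by positivity) k) (poch_pos β hβ k)
  obtain ⟨hfI, horth⟩ := main_L2 β η hβ hη a (fun r h0 h1 => aa_summable α x y hα hx hy r h0 h1)
    (aa_sq_summable α β η x y hα hβ hη hx hy)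
  set f : ℝ × ℝ → ℂ := fun p => ∑' n, (a n : ℂ) * zz p ^ n with hf
  have hfI2 : ∀ k, Integrable (fun p => star (zz p) ^ k * f p) (mu β η) := by
    intro k
    refine hfI.bdd_mul (c := 1) ((continuous_star.comp zz_cont).pow k).aestronglyMeasurable ?_
    filter_upwards [ae_mu β η] with p hp
    simp only [norm_pow, _root_.norm_star]
    exact pow_le_one₀ (norm_nonneg _) (norm_zz_lt p hp).le
  set F : ℕ → ℝ × ℝ → ℍ[ℝ] := fun k p => (cc β η * b k) • (q ^ k * JL I hI (star (zz p) ^ k * f p)) with hF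
  have hFint : ∀ k, Integrable (F k) (mu β η) := fun k =>
    (((JL I hI).integrable_comp (hfI2 k)).const_mul (q ^ k)).smul (cc β η * b k)
  have hFn : ∀ k, ∀ᵐ p ∂(mu β η), ‖F k p‖ ≤ (|cc β η| * (b k * ‖q‖ ^ k)) * ‖f p‖ := by
    intro k
    filter_upwards [ae_mu β η] with p hp
    have h1 : ‖star (zz p) ^ k * f p‖ ≤ ‖f p‖ := by
      rw [norm_mul, norm_pow, _root_.norm_star]
      exact mul_le_of_le_one_left (norm_nonneg _) (pow_le_one₀ (norm_nonneg _) (norm_zz_lt p hp).le)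
    simp only [hF]
    rw [norm_smul, norm_mul (q ^ k), norm_pow q, JL_apply, JJ_norm, Real.norm_eq_abs, abs_mul, abs_of_pos (hbp k)]
    have := (hbp k).le
    calc |cc β η| * b k * (‖q‖ ^ k * ‖star (zz p) ^ k * f p‖) ≤ |cc β η| * b k * (‖q‖ ^ k * ‖f p‖) := by gcongr
      _ = _ := by ring
  have hbs := bb_summable β η hβ hη ‖q‖ (norm_nonneg _) hq
  have hFs : Summable fun k => ∫ p, ‖F k p‖ ∂(mu β η) := by
    refine Summable.of_nonneg_of_le (fun k => integral_nonneg fun p => norm_nonneg _) (fun k => ?_)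
      ((hbs.mul_left |cc β η|).mul_right (∫ p, ‖f p‖ ∂(mu β η)))
    rw [← integral_const_mul]
    exact integral_mono_ae (hFint k).norm (hfI.norm.const_mul _) (hFn k)
  have key := hasSum_integral_of_summable_integral_norm hFint hFs
  have hFi : ∀ k, ∫ p, F k p ∂(mu β η) = a k • q ^ k := by
    intro k
    simp only [hF]
    rw [integral_smul, integral_const_mul_of_integrable ((JL I hI).integrable_comp (hfI2 k)),
      ContinuousLinearMap.integral_comp_comm _ (hfI2 k), horth, JL_apply, JJ_apply]
    have := norm_const β η hβ hη k
    simp only [Complex.ofReal_re, Complex.ofReal_im, zero_smul, add_zero]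
    rw [← Quaternion.coe_commutes, Quaternion.coe_mul_eq_smul, smul_smul]
    congr 1
    linear_combination a k * this
  simp_rw [hFi] at key
  have hR : Rker α q x y = ∑' k, a k • q ^ k := rfl
  rw [hR, key.tsum_eq, integral_mu]
  refine setIntegral_congr_fun meas_Dsc fun p hp => ?_
  have hz := norm_zz_lt p hp
  unfold ww
  congr 1
  rw [← JJ_zz I hI]
  have hsum : Summable fun n => (a n : ℂ) * zz p ^ n := by
    refine Summable.of_norm ((aa_summable α x y hα hx hy ‖zz p‖ (norm_nonneg _) hz).congr fun n => ?_)
    simp [ha]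
  have hRp : Rker α (JJ I hI (zz p)) x y = JL I hI (f p) := by
    simp only [hf]
    rw [(JL I hI).map_tsum hsum]
    unfold Rker
    congr 1
    ext1 n
    rw [JL_apply, map_mul, map_pow, JJ_apply I hI (a n : ℂ)]
    simp only [Complex.ofReal_re, Complex.ofReal_im, zero_smul, add_zero]
    rw [Quaternion.coe_mul_eq_smul]
    rfl
  have hKp : star (Kker β η (JJ I hI (zz p)) q) = ∑' k, (cc β η * b k) • (q ^ k * JL I hI (star (zz p) ^ k)) := by
    unfold Kker
    rw [Quaternion.star_smul, tsum_star, ← tsum_const_smul'']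
    congr 1
    ext1 k
    rw [Quaternion.star_smul, star_mul, star_pow, star_pow, star_star, JJ_star, smul_smul, JL_apply, map_pow]
    simp [cc, hb]
  have hKs : Summable fun k => (cc β η * b k) • (q ^ k * JL I hI (star (zz p) ^ k)) := by
    refine Summable.of_norm_bounded (hbs.mul_left |cc β η|) fun k => ?_
    rw [norm_smul, norm_mul (q ^ k), norm_pow q, JL_apply, JJ_norm, norm_pow, _root_.norm_star, Real.norm_eq_abs, abs_mul, abs_of_pos (hbp k)]
    have := (hbp k).le
    have h1 : ‖zz p‖ ^ k ≤ 1 := pow_le_one₀ (norm_nonneg _) hz.le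
    calc |cc β η| * b k * (‖q‖ ^ k * ‖zz p‖ ^ k) ≤ |cc β η| * b k * (‖q‖ ^ k * 1) := by gcongr
      _ = _ := by simp only [hb]; ring
  rw [hRp, hKp, ← hKs.tsum_mul_right]
  congr 1
  ext1 k
  simp only [hF]
  rw [smul_mul_assoc, mul_assoc, JL_apply, JL_apply, JL_apply, ← map_mul]
end

section
/- Second identity of Proposition KerKer (equation (14)): for every real α > -1, every y ≥ 0, and every quaternion q with ‖q‖ < 1, ∫_0^∞ ‖R_q^α(x,y)‖² x^α e^{-x} dx = Σ_{n=0}^∞ ‖q‖^{2n} φ_n^α(y)², i.e. the L^{2,α}-squared norm of x ↦ R_q^α(x,y) equals R_{‖q‖²}^α(y,y). -/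
open MeasureTheory Real Quaternion

namespace LagAux

lemma gamma_asc (β : ℝ) (hβ : 0 < β) (j : ℕ) :
    Real.Gamma (β + j) = (ascPochhammer ℝ j).eval β * Real.Gamma β := by
  induction j with
  | zero => simp
  | succ j ih =>
    have h : β + j ≠ 0 := by positivity
    rw [ascPochhammer_succ_eval, Nat.cast_succ, ← add_assoc, Real.Gamma_add_one h, ih]
    ring

lemma gamma_pos (α : ℝ) (hα : -1 < α) (n : ℕ) : 0 < Real.Gamma (n + α + 1) :=
  Real.Gamma_pos_of_pos (by have : (0:ℝ) ≤ n := n.cast_nonneg; linarith)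

/-- Gamma ratio bound. -/
lemma gamma_le (β : ℝ) (hβ : 0 < β) (a : ℕ) (ha : β ≤ a + 1) (j : ℕ) :
    Real.Gamma (β + j) ≤ Real.Gamma β * (j.factorial * ((j + a).choose a : ℕ)) := by
  have hG := Real.Gamma_pos_of_pos hβ
  induction j with
  | zero => simp
  | succ j ih =>
    have h : β + j ≠ 0 := by positivity
    rw [Nat.cast_succ, ← add_assoc, Real.Gamma_add_one h]
    have e : ((j + 1 + a).choose a : ℝ) * (j + 1) = (j + a).choose a * (j + a + 1) := by
      have := Nat.add_one_mul_choose_eq (j + a) j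
      have e1 : (j + 1 + a).choose a = (j + a + 1).choose (j + 1) := by
        rw [show j + 1 + a = (j + 1) + a from rfl, Nat.choose_symm_add.symm]
        congr 1; ring
      have e2 : (j + a).choose a = (j + a).choose j := Nat.choose_symm_add.symm
      rw [e1, e2]
      have h3 : ((j + a + 1 : ℕ) : ℝ) * ((j + a).choose j : ℕ) = ((j + a + 1).choose (j + 1) : ℕ) * ((j + 1 : ℕ) : ℝ) := by
        exact_mod_cast this
      push_cast at h3
      linarith
    rw [Nat.factorial_succ]
    push_cast
    calc (β + j) * Real.Gamma (β + j)
        ≤ (a + 1 + j) * (Real.Gamma β * (j.factorial * ((j + a).choose a : ℕ))) := by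
          gcongr
      _ = Real.Gamma β * j.factorial * ((j + a).choose a * (j + a + 1)) := by ring
      _ = _ := by rw [← e]; ring

lemma fact_div_gamma (α : ℝ) (hα : -1 < α) (n : ℕ) :
    (n.factorial : ℝ) / Real.Gamma (n + α + 1) ≤
      (1 / (Real.Gamma (α + 1) * (1 + α))) * (n + 1 + α) := by
  have h1 : 0 < 1 + α := by linarith
  have hG : 0 < Real.Gamma (α + 1) := Real.Gamma_pos_of_pos (by linarith)
  induction n with
  | zero => simp; field_simp; exact le_rfl
  | succ n ih =>
    have hn : (0 : ℝ) ≤ n := n.cast_nonneg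
    have hp : 0 < (n:ℝ) + α + 1 := by linarith
    have hGn := gamma_pos α hα n
    rw [show ((n + 1 : ℕ) : ℝ) + α + 1 = (n + α + 1) + 1 by push_cast; ring,
      Real.Gamma_add_one hp.ne', Nat.factorial_succ]
    push_cast
    set C := 1 / (Real.Gamma (α + 1) * (1 + α)) with hC
    have hCp : 0 < C := by positivity
    calc ((n:ℝ) + 1) * n.factorial / ((n + α + 1) * Real.Gamma (n + α + 1))
        = ((n + 1) / (n + α + 1)) * (n.factorial / Real.Gamma (n + α + 1)) := by
          field_simp
      _ ≤ ((n + 1) / (n + α + 1)) * (C * (n + 1 + α)) := by gcongr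
      _ = C * (n + 1) := by field_simp; ring
      _ ≤ _ := mul_le_mul_of_nonneg_left (by linarith) hCp.le

lemma summable_double (y r : ℝ) (hy : 0 ≤ y) (hr : 0 ≤ r) (hr1 : r < 1) (N : ℕ) :
    Summable (fun p : ℕ × ℕ => y ^ p.1 / p.1.factorial *
      ((p.2 + (p.1 + N)).choose (p.1 + N) : ℕ) * r ^ (p.1 + p.2)) := by
  have hn : ‖r‖ < 1 := by rwa [Real.norm_of_nonneg hr]
  have hs : ∀ k : ℕ, HasSum (fun j : ℕ => y ^ k / k.factorial *
      ((j + (k + N)).choose (k + N) : ℕ) * r ^ (k + j))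
      (y ^ k / k.factorial * r ^ k * (1 / (1 - r) ^ (k + N + 1))) := by
    intro k
    have := (hasSum_choose_mul_geometric_of_norm_lt_one (k + N) hn).mul_left
      (y ^ k / k.factorial * r ^ k)
    have e : (fun j : ℕ => y ^ k / k.factorial *
      ((j + (k + N)).choose (k + N) : ℕ) * r ^ (k + j)) = (fun j : ℕ => y ^ k / k.factorial * r ^ k *
        (((j + (k + N)).choose (k + N) : ℕ) * r ^ j)) := by
      funext j
      rw [pow_add]; ring
    rw [e]
    exact this
  rw [summable_prod_of_nonneg (fun p => by positivity)]
  refine ⟨fun k => (hs k).summable, ?_⟩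
  have h1 : (1 - r) ≠ 0 := by linarith
  have : (fun k : ℕ => ∑' j : ℕ, y ^ k / k.factorial *
      ((j + (k + N)).choose (k + N) : ℕ) * r ^ (k + j)) =
      fun k : ℕ => (y * r / (1 - r)) ^ k / k.factorial * (1 / (1 - r) ^ (N + 1)) := by
    funext k
    rw [(hs k).tsum_eq]
    rw [div_pow, mul_pow]
    field_simp
    ring
  simp only
  rw [this]
  exact (Real.summable_pow_div_factorial _).mul_right _

lemma summable_lag (α : ℝ) (hα : -1 < α) (y r : ℝ) (hy : 0 ≤ y) (hr : 0 ≤ r) (hr1 : r < 1) :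
    Summable (fun n : ℕ => |genLaguerre α n y| * r ^ n) := by
  obtain ⟨N, hN⟩ := exists_nat_ge α
  have h := summable_double y r hy hr hr1 N
  replace h := (Equiv.summable_iff (Finset.HasAntidiagonal.sigmaAntidiagonalEquivProd (A := ℕ))).mpr h
  have h2 := h.sigma
  refine Summable.of_nonneg_of_le (fun n => by positivity) (fun n => ?_) h2
  rw [tsum_fintype]
  simp only [Function.comp, Finset.HasAntidiagonal.sigmaAntidiagonalEquivProd_apply]
  rw [Finset.univ_eq_attach,
    Finset.sum_attach (Finset.HasAntidiagonal.antidiagonal n) (fun p : ℕ × ℕ => y ^ p.1 / p.1.factorial *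
      ((p.2 + (p.1 + N)).choose (p.1 + N) : ℕ) * r ^ (p.1 + p.2)),
    Finset.Nat.sum_antidiagonal_eq_sum_range_succ_mk]
  unfold genLaguerre
  refine (mul_le_mul_of_nonneg_right (Finset.abs_sum_le_sum_abs _ _) (by positivity)).trans ?_
  rw [Finset.sum_mul]
  refine Finset.sum_le_sum fun k hk => ?_
  have hk' : k ≤ n := by simpa [Nat.lt_succ_iff] using hk
  obtain ⟨j, rfl⟩ := Nat.exists_eq_add_of_le hk'
  have hG := gamma_pos α hα k
  have hG2 := gamma_pos α hα (k + j)
  have hb := gamma_le (k + α + 1) (by have : (0:ℝ) ≤ k := k.cast_nonneg; linarith) (k + N)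
    (by push_cast; linarith) j
  rw [show (k:ℝ) + α + 1 + j = (k + j : ℕ) + α + 1 by push_cast; ring] at hb
  simp only [Nat.add_sub_cancel_left]
  rw [abs_mul, abs_mul, abs_div, abs_pow, abs_neg, abs_one, one_pow, abs_of_nonneg (pow_nonneg hy k),
    abs_of_pos (show (0:ℝ) < k.factorial by positivity), abs_of_pos (by positivity)]
  have : Real.Gamma ((k + j : ℕ) + α + 1) / (Real.Gamma (k + α + 1) * j.factorial) ≤
      ((j + (k + N)).choose (k + N) : ℕ) := by
    rw [div_le_iff₀ (by positivity)]
    linarith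
  calc _ ≤ 1 / (k.factorial : ℝ) * ((j + (k + N)).choose (k + N) : ℕ) * y ^ k * r ^ (k + j) := by
        gcongr
    _ = _ := by ring

lemma summable_phi (α : ℝ) (hα : -1 < α) (y r : ℝ) (hy : 0 ≤ y) (hr : 0 ≤ r) (hr1 : r < 1) :
    Summable (fun n : ℕ => |lagPhi α n y| * r ^ n) := by
  set s := Real.sqrt r with hs
  have hs0 : 0 ≤ s := Real.sqrt_nonneg r
  have hs1 : s < 1 := by rw [hs, Real.sqrt_lt' one_pos]; simpa
  have hss : s * s = r := Real.mul_self_sqrt hr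
  have h1 := summable_lag α hα y s hy hs0 hs1
  set C := 1 / (Real.Gamma (α + 1) * (1 + α)) with hC
  have hsn : ‖s‖ < 1 := by rwa [Real.norm_of_nonneg hs0]
  have h2 : Summable (fun n : ℕ => (1 + C * (n + 1 + α)) * s ^ n) := by
    have a := (summable_geometric_of_norm_lt_one hsn).mul_left (1 + C * (1 + α))
    have b := (summable_pow_mul_geometric_of_norm_lt_one 1 hsn).mul_left C
    refine (a.add b).congr fun n => ?_
    ring
  have hC0 : 0 < C := by
    have := Real.Gamma_pos_of_pos (show 0 < α + 1 by linarith)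
    have : 0 < 1 + α := by linarith
    positivity
  have hP : ∀ n : ℕ, 0 ≤ 1 + C * (n + 1 + α) := by
    intro n
    have : (0:ℝ) ≤ n := n.cast_nonneg
    have : 0 ≤ (n:ℝ) + 1 + α := by linarith
    positivity
  have h3 := h1.mul_of_nonneg h2 (fun n => by positivity) (fun n => mul_nonneg (hP n) (by positivity))
  have h4 := h3.comp_injective (i := fun n : ℕ => (n, n)) (fun a b h => by simpa using h)
  refine Summable.of_nonneg_of_le (fun n => by positivity) (fun n => ?_) h4
  simp only [Function.comp]
  unfold lagPhi
  rw [abs_mul, abs_of_nonneg (Real.sqrt_nonneg _), ← hss, mul_pow]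
  have hb := fact_div_gamma α hα n
  rw [← hC] at hb
  have hg : 0 ≤ (n.factorial : ℝ) / Real.Gamma (n + α + 1) :=
    div_nonneg (by positivity) (gamma_pos α hα n).le
  have hsq : Real.sqrt ((n.factorial : ℝ) / Real.Gamma (n + α + 1)) ≤ 1 + C * (n + 1 + α) := by
    rw [Real.sqrt_le_iff]
    refine ⟨hP n, ?_⟩
    nlinarith [hP n]
  calc _ ≤ (1 + C * (n + 1 + α)) * |genLaguerre α n y| * (s ^ n * s ^ n) := by gcongr
    _ = _ := by ring

/-- The weight. -/
noncomputable def wt (α x : ℝ) : ℝ := x ^ α * Real.exp (-x)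

lemma mono_eq (α : ℝ) (j : ℕ) {x : ℝ} (hx : 0 < x) :
    x ^ j * wt α x = Real.exp (-x) * x ^ ((j + α + 1 : ℝ) - 1) := by
  unfold wt
  rw [show (j + α + 1 : ℝ) - 1 = j + α by ring, Real.rpow_add hx, Real.rpow_natCast]
  ring

lemma int_mono (α : ℝ) (hα : -1 < α) (j : ℕ) :
    IntegrableOn (fun x => x ^ j * wt α x) (Set.Ioi 0) :=
  (Real.GammaIntegral_convergent (s := j + α + 1)
    (by have : (0:ℝ) ≤ j := j.cast_nonneg; linarith)).congr_fun
    (fun x hx => (mono_eq α j hx).symm) measurableSet_Ioi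

lemma integral_mono (α : ℝ) (hα : -1 < α) (j : ℕ) :
    ∫ x in Set.Ioi (0:ℝ), x ^ j * wt α x = Real.Gamma (j + α + 1) := by
  rw [Real.Gamma_eq_integral (s := j + α + 1)
    (by have : (0:ℝ) ≤ j := j.cast_nonneg; linarith)]
  exact setIntegral_congr_fun measurableSet_Ioi (fun x hx => mono_eq α j hx)

/-- Coefficients. -/
noncomputable def cf (α : ℝ) (n k : ℕ) : ℝ := ((-1 : ℝ) ^ k / (Nat.factorial k)) *
      (Real.Gamma (n + α + 1) / (Real.Gamma (k + α + 1) * (Nat.factorial (n - k))))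

lemma lag_eq (α : ℝ) (n : ℕ) (x : ℝ) :
    genLaguerre α n x = ∑ k ∈ Finset.range (n + 1), cf α n k * x ^ k := rfl

lemma lag_mul (α : ℝ) (n j : ℕ) (x : ℝ) : genLaguerre α n x * x ^ j * wt α x =
    ∑ k ∈ Finset.range (n + 1), cf α n k * (x ^ (k + j) * wt α x) := by
  rw [lag_eq, Finset.sum_mul, Finset.sum_mul]
  refine Finset.sum_congr rfl fun k _ => ?_
  rw [pow_add]; ring

lemma int_lag_pow (α : ℝ) (hα : -1 < α) (n j : ℕ) :
    IntegrableOn (fun x => genLaguerre α n x * x ^ j * wt α x) (Set.Ioi 0) := by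
  simp_rw [lag_mul]
  exact integrable_finsetSum _ fun k _ => (int_mono α hα (k + j)).const_mul _

lemma integral_lag_pow (α : ℝ) (hα : -1 < α) (n j : ℕ) :
    ∫ x in Set.Ioi (0:ℝ), genLaguerre α n x * x ^ j * wt α x =
      Real.Gamma (n + α + 1) / n.factorial * ((-1) ^ n *
        (fwdDiff 1)^[n] (ascPochhammer ℝ j).eval (α + 1)) := by
  simp_rw [lag_mul]
  rw [integral_finsetSum _ fun k _ => (int_mono α hα (k + j)).const_mul _]
  rw [fwdDiff_iter_eq_sum_shift, Finset.mul_sum, Finset.mul_sum]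
  refine Finset.sum_congr rfl fun k hk => ?_
  rw [integral_const_mul, integral_mono α hα]
  have hk' : k ≤ n := by simpa [Nat.lt_succ_iff] using hk
  have hG := gamma_pos α hα k
  have := gamma_asc (k + α + 1) (by have : (0:ℝ) ≤ k := k.cast_nonneg; linarith) j
  rw [show ((k + j : ℕ) : ℝ) + α + 1 = k + α + 1 + j by push_cast; ring, this]
  obtain ⟨i, rfl⟩ := Nat.exists_eq_add_of_le hk'
  unfold cf
  have hc : ((k + i).choose k : ℝ) * (k.factorial * i.factorial) = (k + i).factorial := by
    have := Nat.add_choose_mul_factorial_mul_factorial k i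
    rw [← Nat.choose_symm_add] at this
    rw [← mul_assoc]; exact_mod_cast this
  rw [show α + 1 + k • (1:ℝ) = k + α + 1 by simp; ring]
  simp only [Nat.add_sub_cancel_left, zsmul_eq_mul]
  push_cast
  rw [← hc]
  have h1 : (0:ℝ) < k.factorial := by positivity
  have h2 : (0:ℝ) < i.factorial := by positivity
  have h3 : (0:ℝ) < (k + i).choose k := by exact_mod_cast Nat.choose_pos (Nat.le_add_right k i)
  have h4 : (-1:ℝ) ^ (k + i) * (-1) ^ i = (-1) ^ k := by
    rw [pow_add, mul_assoc, ← mul_pow]; simp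
  rw [← h4]
  field_simp

lemma integral_lag_pow_lt (α : ℝ) (hα : -1 < α) (n j : ℕ) (h : j < n) :
    ∫ x in Set.Ioi (0:ℝ), genLaguerre α n x * x ^ j * wt α x = 0 := by
  rw [integral_lag_pow α hα, Polynomial.fwdDiff_iter_eq_zero_of_degree_lt
    (by rwa [ascPochhammer_natDegree])]
  simp

lemma integral_lag_pow_self (α : ℝ) (hα : -1 < α) (n : ℕ) :
    ∫ x in Set.Ioi (0:ℝ), genLaguerre α n x * x ^ n * wt α x =
      Real.Gamma (n + α + 1) * (-1) ^ n := by
  rw [integral_lag_pow α hα]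
  have := Polynomial.fwdDiff_iter_degree_eq_factorial (ascPochhammer ℝ n)
  rw [ascPochhammer_natDegree, (monic_ascPochhammer ℝ n).leadingCoeff] at this
  rw [this]
  have h1 : (0:ℝ) < n.factorial := by positivity
  simp
  field_simp

lemma lag_lag (α : ℝ) (n m : ℕ) (x : ℝ) : genLaguerre α n x * genLaguerre α m x * wt α x =
    ∑ j ∈ Finset.range (m + 1), cf α m j * (genLaguerre α n x * x ^ j * wt α x) := by
  rw [lag_eq α m, Finset.mul_sum, Finset.sum_mul]
  refine Finset.sum_congr rfl fun k _ => ?_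
  ring

lemma int_lag_lag (α : ℝ) (hα : -1 < α) (n m : ℕ) :
    IntegrableOn (fun x => genLaguerre α n x * genLaguerre α m x * wt α x) (Set.Ioi 0) := by
  simp_rw [lag_lag]
  exact integrable_finsetSum _ fun k _ => (int_lag_pow α hα n k).const_mul _

lemma integral_lag_lag_lt (α : ℝ) (hα : -1 < α) (n m : ℕ) (h : m < n) :
    ∫ x in Set.Ioi (0:ℝ), genLaguerre α n x * genLaguerre α m x * wt α x = 0 := by
  simp_rw [lag_lag]
  rw [integral_finsetSum _ fun k _ => (int_lag_pow α hα n k).const_mul _]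
  refine Finset.sum_eq_zero fun k hk => ?_
  have := Finset.mem_range.1 hk
  rw [integral_const_mul, integral_lag_pow_lt α hα n k (by omega), mul_zero]

lemma integral_lag_lag_self (α : ℝ) (hα : -1 < α) (n : ℕ) :
    ∫ x in Set.Ioi (0:ℝ), genLaguerre α n x * genLaguerre α n x * wt α x =
      Real.Gamma (n + α + 1) / n.factorial := by
  simp_rw [lag_lag]
  rw [integral_finsetSum _ fun k _ => (int_lag_pow α hα n k).const_mul _, Finset.sum_range_succ,
    Finset.sum_eq_zero, zero_add, integral_const_mul, integral_lag_pow_self α hα]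
  · unfold cf
    have hG := gamma_pos α hα n
    have h4 : (-1:ℝ) ^ n * (-1) ^ n = 1 := by rw [← mul_pow]; simp
    simp
    field_simp
    rw [pow_two, h4]
  · intro k hk
    rw [integral_const_mul, integral_lag_pow_lt α hα n k (Finset.mem_range.1 hk), mul_zero]

lemma phi_phi (α : ℝ) (n m : ℕ) (x : ℝ) : lagPhi α n x * lagPhi α m x * wt α x =
    (Real.sqrt ((Nat.factorial n : ℝ) / Real.Gamma (n + α + 1)) *
     Real.sqrt ((Nat.factorial m : ℝ) / Real.Gamma (m + α + 1))) *
     (genLaguerre α n x * genLaguerre α m x * wt α x) := by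
  unfold lagPhi; ring

lemma int_phi (α : ℝ) (hα : -1 < α) (n m : ℕ) :
    IntegrableOn (fun x => lagPhi α n x * lagPhi α m x * wt α x) (Set.Ioi 0) := by
  simp_rw [phi_phi]
  exact (int_lag_lag α hα n m).const_mul _

lemma integral_phi (α : ℝ) (hα : -1 < α) (n m : ℕ) :
    ∫ x in Set.Ioi (0:ℝ), lagPhi α n x * lagPhi α m x * wt α x = if n = m then 1 else 0 := by
  simp_rw [phi_phi]
  rw [integral_const_mul]
  rcases lt_trichotomy n m with h | h | h
  · simp_rw [mul_comm (genLaguerre α n _)]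
    rw [integral_lag_lag_lt α hα m n h, if_neg h.ne, mul_zero]
  · subst h
    have hG := gamma_pos α hα n
    rw [integral_lag_lag_self α hα, if_pos rfl, Real.mul_self_sqrt (by positivity)]
    field_simp
  · rw [integral_lag_lag_lt α hα n m h, if_neg h.ne', mul_zero]

lemma wt_nonneg (α : ℝ) {x : ℝ} (hx : 0 < x) : 0 ≤ wt α x := by unfold wt; positivity

lemma integral_abs_phi (α : ℝ) (hα : -1 < α) (n m : ℕ) :
    ∫ x in Set.Ioi (0:ℝ), ‖lagPhi α n x * lagPhi α m x * wt α x‖ ≤ 1 := by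
  have h : ∫ x in Set.Ioi (0:ℝ), ‖lagPhi α n x * lagPhi α m x * wt α x‖ ≤
      ∫ x in Set.Ioi (0:ℝ), (1 / 2 * (lagPhi α n x * lagPhi α n x * wt α x) +
        1 / 2 * (lagPhi α m x * lagPhi α m x * wt α x)) := by
    refine setIntegral_mono_on (int_phi α hα n m).norm
      (((int_phi α hα n n).const_mul _).add ((int_phi α hα m m).const_mul _))
      measurableSet_Ioi fun x hx => ?_
    have hw := wt_nonneg α hx
    rw [norm_mul, Real.norm_of_nonneg hw, Real.norm_eq_abs, abs_mul]
    have : |lagPhi α n x| * |lagPhi α m x| ≤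
      1 / 2 * (lagPhi α n x * lagPhi α n x) + 1 / 2 * (lagPhi α m x * lagPhi α m x) := by
      nlinarith [sq_nonneg (|lagPhi α n x| - |lagPhi α m x|), abs_mul_abs_self (lagPhi α n x),
        abs_mul_abs_self (lagPhi α m x)]
    nlinarith
  refine h.trans ?_
  rw [integral_add ((int_phi α hα n n).const_mul _) ((int_phi α hα m m).const_mul _),
    integral_const_mul, integral_const_mul, integral_phi α hα, integral_phi α hα]
  norm_num

/-- Real part as an additive map. -/
noncomputable def reHom : ℍ[ℝ] →+ ℝ where
  toFun a := a.re
  map_zero' := rfl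
  map_add' _ _ := rfl

lemma reHom_apply (a : ℍ[ℝ]) : reHom a = a.re := rfl

lemma summable_ker (α : ℝ) (hα : -1 < α) (x y : ℝ) (hx : 0 ≤ x) (hy : 0 ≤ y)
    (q : ℍ[ℝ]) (hq : ‖q‖ < 1) :
    Summable (fun n : ℕ => ‖(lagPhi α n x * lagPhi α n y) • q ^ n‖) := by
  set s := Real.sqrt ‖q‖ with hs
  have hs0 : 0 ≤ s := Real.sqrt_nonneg _
  have hs1 : s < 1 := by rw [hs, Real.sqrt_lt' one_pos]; simpa
  have hss : s * s = ‖q‖ := Real.mul_self_sqrt (norm_nonneg q)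
  have h3 := (summable_phi α hα x s hx hs0 hs1).mul_of_nonneg (summable_phi α hα y s hy hs0 hs1)
    (fun n => by positivity) (fun n => by positivity)
  have h4 := h3.comp_injective (i := fun n : ℕ => (n, n)) (fun a b h => by simpa using h)
  refine h4.congr fun n => ?_
  simp only [Function.comp]
  rw [norm_smul, norm_pow, ← hss, mul_pow, Real.norm_eq_abs, abs_mul]
  ring

lemma sq_auxA (f : ℕ → ℍ[ℝ]) (hsum : Summable (fun n => ‖f n‖)) : Summable (fun n => ‖star (f n)‖) := by simpa only [norm_star] using hsum
lemma sq_auxB (f : ℕ → ℍ[ℝ]) (hsum : Summable (fun n => ‖f n‖)) : 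
   HasSum f (∑' n, f n) := hsum.of_norm.hasSum
lemma sq_auxC (f : ℕ → ℍ[ℝ])  (R) (h1: HasSum f R): HasSum (fun n => star (f n)) (star R) := h1.star
lemma sq_auxD (f g: ℕ → ℍ[ℝ])  (R S) (h1: HasSum f R) (h2: HasSum g S) (hs : Summable (fun n => ‖f n‖))
 (hs' : Summable (fun n => ‖g n‖)): HasSum (fun n : ℕ × ℕ => f n.1 * g n.2) (R * S) := h1.mul h2 (summable_mul_of_summable_norm hs hs')
lemma sq_auxE (f : ℕ × ℕ → ℍ[ℝ])  (R) (h1: HasSum f R): HasSum (fun n => (f n).re) (R.re) := h1.map reHom Quaternion.continuous_re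
lemma sq_auxF (R : ℍ[ℝ]) : (R * star R).re = ‖R‖ ^ 2 := by
    rw [← Quaternion.inner_def, real_inner_self_eq_norm_sq]

lemma hasSum_sq (f : ℕ → ℍ[ℝ]) (hsum : Summable (fun n => ‖f n‖)) :
    HasSum (fun p : ℕ × ℕ => (f p.1 * star (f p.2)).re) (‖∑' n, f n‖ ^ 2) := by
  have h3 := sq_auxD f (fun n => star (f n)) _ _ (sq_auxB f hsum) (sq_auxC f _ (sq_auxB f hsum))
    hsum (sq_auxA f hsum)
  have h4 := sq_auxE _ _ h3
  rw [sq_auxF] at h4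
  exact h4

lemma re_term (a b c d : ℝ) (u v : ℍ[ℝ]) :
    ((a * b) • u * star ((c * d) • v)).re = a * c * (b * d * (u * star v).re) := by
  rw [Quaternion.star_smul, smul_mul_assoc, mul_smul_comm, Quaternion.re_smul, Quaternion.re_smul]
  simp only [smul_eq_mul]
  ring

/-- Double-series form of `‖R‖²`. -/
lemma hasSum_norm_sq (α : ℝ) (hα : -1 < α) (x y : ℝ) (hx : 0 ≤ x) (hy : 0 ≤ y)
    (q : ℍ[ℝ]) (hq : ‖q‖ < 1) :
    HasSum (fun p : ℕ × ℕ => lagPhi α p.1 x * lagPhi α p.2 x *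
      (lagPhi α p.1 y * lagPhi α p.2 y * (q ^ p.1 * star (q ^ p.2)).re)) (‖Rker α q x y‖ ^ 2) := by
  have h := hasSum_sq _ (summable_ker α hα x y hx hy q hq)
  simp only [re_term] at h
  unfold Rker
  exact h

end LagAux

/-- Second identity of Proposition KerKer (equation (14)): the squared
`L^{2,α}`-norm of `x ↦ R_q^α(x,y)` equals `R_{‖q‖²}^α(y,y)`. -/
theorem stmt_4 (α : ℝ) (hα : -1 < α) (y : ℝ) (hy : 0 ≤ y) (q : ℍ[ℝ]) (hq : ‖q‖ < 1) :
    (∫ x in Set.Ioi (0 : ℝ), ‖Rker α q x y‖ ^ 2 * (x ^ α * Real.exp (-x))) =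
      ∑' n : ℕ, ‖q‖ ^ (2 * n) * (lagPhi α n y) ^ 2 := by
  have key := fun x (hx : x ∈ Set.Ioi (0:ℝ)) =>
    LagAux.hasSum_norm_sq α hα x y (le_of_lt hx) hy q hq
  set c : ℕ × ℕ → ℝ := fun p =>
    lagPhi α p.1 y * lagPhi α p.2 y * (q ^ p.1 * star (q ^ p.2)).re with hc
  set F : ℕ × ℕ → ℝ → ℝ := fun p x =>
    c p * (lagPhi α p.1 x * lagPhi α p.2 x * LagAux.wt α x) with hF
  have hre : ∀ a : ℍ[ℝ], |a.re| ≤ ‖a‖ := by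
    intro a
    have := abs_real_inner_le_norm a 1
    simpa [Quaternion.inner_def] using this
  have hcs : Summable (fun p => |c p|) := by
    have h := LagAux.summable_phi α hα y ‖q‖ hy (norm_nonneg q) hq
    have h3 := h.mul_of_nonneg h (fun n => by positivity) (fun n => by positivity)
    refine Summable.of_nonneg_of_le (fun p => abs_nonneg _) (fun p => ?_) h3
    rw [hc]
    simp only
    rw [abs_mul, abs_mul]
    have := hre (q ^ p.1 * star (q ^ p.2))
    rw [norm_mul, norm_star, norm_pow, norm_pow] at this
    calc _ ≤ |lagPhi α p.1 y| * |lagPhi α p.2 y| * (‖q‖ ^ p.1 * ‖q‖ ^ p.2) := by gcongr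
      _ = _ := by ring
  have hFi : ∀ p, Integrable (F p) (volume.restrict (Set.Ioi 0)) := fun p =>
    (LagAux.int_phi α hα p.1 p.2).const_mul _
  have hFs : Summable fun p => ∫ x in Set.Ioi (0:ℝ), ‖F p x‖ := by
    refine Summable.of_nonneg_of_le (fun p => integral_nonneg fun x => norm_nonneg _)
      (fun p => ?_) hcs
    simp only [hF, norm_mul (c p)]
    rw [integral_const_mul, Real.norm_eq_abs]
    exact mul_le_of_le_one_right (abs_nonneg _) (LagAux.integral_abs_phi α hα p.1 p.2)
  have hmain := hasSum_integral_of_summable_integral_norm hFi hFs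
  have hL : (∫ x in Set.Ioi (0 : ℝ), ‖Rker α q x y‖ ^ 2 * (x ^ α * Real.exp (-x))) =
      ∫ x in Set.Ioi (0 : ℝ), ∑' p, F p x := by
    refine setIntegral_congr_fun measurableSet_Ioi fun x hx => ?_
    have := ((key x hx).mul_right (x ^ α * Real.exp (-x))).tsum_eq
    rw [← this]
    refine tsum_congr fun p => ?_
    simp only [hF, hc, LagAux.wt]
    ring
  rw [hL, ← hmain.tsum_eq]
  have hdi : Function.Injective (fun n : ℕ => (n, n)) := fun a b h => by simpa using h
  rw [← hdi.tsum_eq]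
  · refine tsum_congr fun n => ?_
    simp only [hF]
    rw [integral_const_mul, LagAux.integral_phi α hα, if_pos rfl, mul_one]
    simp only [hc]
    rw [← Quaternion.inner_def, real_inner_self_eq_norm_sq, norm_pow]
    ring
  · intro p hp
    rw [Function.mem_support] at hp
    by_contra hne
    apply hp
    simp only [hF]
    rw [integral_const_mul, LagAux.integral_phi α hα, if_neg, mul_zero]
    intro h
    exact hne ⟨p.1, Prod.ext rfl h⟩
end

section
/- Well-definedness and pointwise bound for the dual transform: let α > -1, y ≥ 0, and let φ : (0,∞) → ℍ be measurable with ∫_0^∞ ‖φ(x)‖² x^α e^{-x} dx < ∞. Then for every quaternion q with ‖q‖ < 1 the function x ↦ R_q^α(x,y) φ(x) is integrable on (0,∞) with respect to x^α e^{-x} dx, and ‖S_y^α φ(q)‖² ≤ (Σ_{n=0}^∞ ‖q‖^{2n} φ_n^α(y)²) · ∫_0^∞ ‖φ(x)‖² x^α e^{-x} dx. -/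
open MeasureTheory Real Quaternion

/-- The dual transform `S_y^α φ(q) = ∫_0^∞ R_q^α(x,y) φ(x) x^α e^{-x} dx`. -/
noncomputable def Sdual (α y : ℝ) (φ : ℝ → ℍ[ℝ]) (q : ℍ[ℝ]) : ℍ[ℝ] :=
  ∫ x in Set.Ioi (0 : ℝ), (x ^ α * Real.exp (-x)) • (Rker α q x y * φ x)


lemma aux_gamma_ratio (α : ℝ) (hα : -1 < α) (A : ℕ) (hA : α ≤ A) (k m : ℕ) :
    Real.Gamma ((k + m : ℕ) + α + 1) * ((k + A).factorial : ℝ)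
      ≤ ((k + m + A).factorial : ℝ) * Real.Gamma (k + α + 1) := by
  induction m with
  | zero => simp [mul_comm]
  | succ m ih =>
    have hk : (0 : ℝ) ≤ k := Nat.cast_nonneg k
    have hm : (0 : ℝ) ≤ m := Nat.cast_nonneg m
    have h1 : Real.Gamma ((k + (m + 1) : ℕ) + α + 1)
        = (k + m + α + 1) * Real.Gamma ((k + m : ℕ) + α + 1) := by
      have := Real.Gamma_add_one (s := ((k + m : ℕ) : ℝ) + α + 1) (by push_cast; linarith)
      push_cast at this ⊢
      rw [← this]; congr 1; ring
    have h2 : ((k + (m + 1) + A).factorial : ℝ) = (k + m + A + 1) * ((k + m + A).factorial : ℝ) := by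
      rw [show k + (m + 1) + A = (k + m + A) + 1 by ring, Nat.factorial_succ]; push_cast; ring
    have hG : 0 < Real.Gamma ((k + m : ℕ) + α + 1) := Real.Gamma_pos_of_pos (by push_cast; linarith)
    rw [h1, h2, mul_assoc, mul_assoc]
    apply mul_le_mul (by linarith) ih (by positivity)
    have : (0 : ℝ) ≤ A := Nat.cast_nonneg A
    linarith

lemma aux_choose (s : ℝ) (hs0 : 0 < s) (hs1 : s < 1) (N m : ℕ) (h : m ≤ N) :
    (N.choose m : ℝ) * s ^ m * (1 - s) ^ (N - m) ≤ 1 := by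
  have h1 : (1 : ℝ) = (s + (1 - s)) ^ N := by simp
  have := Finset.single_le_sum (s := Finset.range (N + 1))
    (f := fun i => s ^ i * (1 - s) ^ (N - i) * (N.choose i : ℝ))
    (fun i _ => by have : 0 < 1 - s := by linarith
                   positivity) (a := m) (by simp; omega)
  calc _ = s ^ m * (1 - s) ^ (N - m) * (N.choose m : ℝ) := by ring
    _ ≤ ∑ i ∈ Finset.range (N + 1), s ^ i * (1 - s) ^ (N - i) * (N.choose i : ℝ) := this
    _ = 1 := by rw [← add_pow, ← h1]

lemma aux_lag_bound (α : ℝ) (hα : -1 < α) (x s : ℝ) (hs0 : 0 < s) (hs1 : s < 1) :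
    ∃ C : ℝ, 0 ≤ C ∧ ∀ n : ℕ, |genLaguerre α n x| ≤ C * (s⁻¹) ^ n := by
  obtain ⟨A, hA⟩ := exists_nat_ge α
  have hs : 0 < 1 - s := by linarith
  refine ⟨((1 - s)⁻¹) ^ A * Real.exp (|x| * s / (1 - s)), by positivity, fun n => ?_⟩
  have key : ∀ k ∈ Finset.range (n + 1),
      |((-1 : ℝ) ^ k / (Nat.factorial k)) *
      (Real.Gamma (n + α + 1) / (Real.Gamma (k + α + 1) * (Nat.factorial (n - k)))) * x ^ k|
      ≤ (((1 - s)⁻¹) ^ A * (s⁻¹) ^ n) * ((|x| * s / (1 - s)) ^ k / k.factorial) := by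
    intro k hk
    obtain ⟨m, rfl⟩ : ∃ m, n = k + m := ⟨n - k, by simp at hk; omega⟩
    have hk : (0 : ℝ) ≤ k := Nat.cast_nonneg k
    have hm : (0 : ℝ) ≤ m := Nat.cast_nonneg m
    have hG1 : 0 < Real.Gamma ((k + m : ℕ) + α + 1) := Real.Gamma_pos_of_pos (by push_cast; linarith)
    have hG2 : 0 < Real.Gamma (k + α + 1) := Real.Gamma_pos_of_pos (by linarith)
    have h1 := aux_gamma_ratio α hα A hA k m
    have h2 := aux_choose s hs0 hs1 (k + m + A) m (by omega)
    rw [show k + m + A - m = k + A by omega] at h2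
    have h3 : ((k + m + A).choose m : ℝ) = (k+m+A).factorial / (m.factorial * (k + A).factorial) := by
      rw [Nat.cast_choose ℝ (by omega : m ≤ k + m + A), show k + m + A - m = k + A by omega]
    have h4 : Real.Gamma ((k + m : ℕ) + α + 1) / (Real.Gamma (k + α + 1) * (Nat.factorial m))
        ≤ ((k + m + A).choose m : ℝ) := by
      rw [h3, div_le_div_iff₀ (by positivity) (by positivity)]
      calc _ = (Real.Gamma ((k + m : ℕ) + α + 1) * ((k + A).factorial : ℝ)) * m.factorial := by ring
        _ ≤ (((k + m + A).factorial : ℝ) * Real.Gamma (k + α + 1)) * m.factorial := by gcongr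
        _ = _ := by ring
    have h5 : ((k + m + A).choose m : ℝ) ≤ (s⁻¹) ^ m * ((1 - s)⁻¹) ^ (k + A) := by
      rw [inv_pow, inv_pow, ← mul_inv, ← one_div, le_div_iff₀ (by positivity), ← mul_assoc]
      exact h2
    rw [show k + m - k = m by omega, abs_mul, abs_mul, abs_div, abs_pow, abs_pow, abs_neg, abs_one,
      one_pow, Nat.abs_cast, abs_of_pos (a := Real.Gamma _ / _) (by positivity)]
    calc _ ≤ 1 / (k.factorial : ℝ) * ((s⁻¹) ^ m * ((1 - s)⁻¹) ^ (k + A)) * |x| ^ k := by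
          gcongr; exact h4.trans h5
      _ = _ := by
          simp only [div_pow, mul_pow, pow_add, inv_pow]
          field_simp
  unfold genLaguerre
  refine (Finset.abs_sum_le_sum_abs _ _).trans ((Finset.sum_le_sum key).trans ?_)
  rw [← Finset.mul_sum]
  have := Real.sum_le_exp_of_nonneg (x := |x| * s / (1 - s)) (by positivity) (n + 1)
  calc _ ≤ (((1 - s)⁻¹) ^ A * (s⁻¹) ^ n) * Real.exp (|x| * s / (1 - s)) := by gcongr
    _ = _ := by ring

lemma aux_norm_bound (α : ℝ) (hα : -1 < α) (n : ℕ) :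
    (n.factorial : ℝ) / Real.Gamma (n + α + 1) ≤ (n + α + 1) / Real.Gamma (α + 2) := by
  have hn : (0 : ℝ) ≤ n := Nat.cast_nonneg n
  have h : ∀ n : ℕ, (n.factorial : ℝ) * Real.Gamma (α + 2) ≤ Real.Gamma (n + α + 2) := by
    intro n
    induction n with
    | zero => simp
    | succ n ih =>
      have hn : (0 : ℝ) ≤ n := Nat.cast_nonneg n
      have := Real.Gamma_add_one (s := (n : ℝ) + α + 2) (by linarith)
      have e : ((n + 1 : ℕ) : ℝ) + α + 2 = n + α + 2 + 1 := by push_cast; ring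
      rw [e, this, Nat.factorial_succ]
      push_cast
      have : 0 < Real.Gamma (α + 2) := Real.Gamma_pos_of_pos (by linarith)
      rw [mul_assoc]
      apply mul_le_mul (by linarith) ih (by positivity) (by linarith)
  have h1 : 0 < Real.Gamma (n + α + 1) := Real.Gamma_pos_of_pos (by linarith)
  have h2 : 0 < Real.Gamma (α + 2) := Real.Gamma_pos_of_pos (by linarith)
  rw [div_le_div_iff₀ h1 h2]
  have := Real.Gamma_add_one (s := (n : ℝ) + α + 1) (by linarith)
  rw [← this]
  have e : (n : ℝ) + α + 1 + 1 = n + α + 2 := by ring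
  rw [e]
  exact h n

lemma aux_summable (α : ℝ) (hα : -1 < α) (x r : ℝ) (hr0 : 0 ≤ r) (hr1 : r < 1) :
    Summable fun n : ℕ => r ^ n * (lagPhi α n x) ^ 2 := by
  obtain ⟨s, hs0, hs1⟩ : ∃ s, Real.sqrt r < s ∧ s < 1 :=
    exists_between (by rw [Real.sqrt_lt' one_pos]; simpa)
  have hs : 0 < s := (Real.sqrt_nonneg r).trans_lt hs0
  have hrs : r < s ^ 2 := (Real.sqrt_lt' hs).1 hs0
  obtain ⟨C, hC, hb⟩ := aux_lag_bound α hα x s hs hs1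
  have h2 : 0 < Real.Gamma (α + 2) := Real.Gamma_pos_of_pos (by linarith)
  set t := r / s ^ 2 with ht
  have ht0 : 0 ≤ t := by positivity
  have ht1 : t < 1 := by rw [ht, div_lt_one (by positivity)]; exact hrs
  have hsum : Summable fun n : ℕ => C ^ 2 / Real.Gamma (α + 2) * ((n : ℝ) * t ^ n + (α + 1) * t ^ n) := by
    apply Summable.mul_left
    apply Summable.add
    · have := summable_pow_mul_geometric_of_norm_lt_one (R := ℝ) 1 (r := t)
        (by rwa [Real.norm_of_nonneg ht0])
      simpa using this
    · exact (summable_geometric_of_lt_one ht0 ht1).mul_left _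
  refine Summable.of_nonneg_of_le (fun n => by positivity) (fun n => ?_) hsum
  have hn : (0 : ℝ) ≤ n := Nat.cast_nonneg n
  have h1 : 0 < Real.Gamma (n + α + 1) := Real.Gamma_pos_of_pos (by linarith)
  unfold lagPhi
  rw [mul_pow, Real.sq_sqrt (by positivity), ← sq_abs (genLaguerre α n x)]
  calc _ ≤ r ^ n * (((n + α + 1) / Real.Gamma (α + 2)) * (C * (s⁻¹) ^ n) ^ 2) := by
        have h3 := aux_norm_bound α hα n
        have h4 := hb n
        have h5 : 0 ≤ (n : ℝ) + α + 1 := by linarith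
        apply mul_le_mul_of_nonneg_left _ (by positivity)
        exact mul_le_mul h3 (pow_le_pow_left₀ (abs_nonneg _) h4 2) (by positivity) (by positivity)
    _ = _ := by
        rw [ht, div_pow, ← pow_mul, inv_pow, mul_comm 2 n, pow_mul]
        field_simp
        ring

lemma aux_moment (α : ℝ) (hα : -1 < α) (k : ℕ) :
    IntegrableOn (fun x : ℝ => x ^ k * (x ^ α * Real.exp (-x))) (Set.Ioi 0) ∧
    ∫ x in Set.Ioi (0 : ℝ), x ^ k * (x ^ α * Real.exp (-x)) = Real.Gamma (k + α + 1) := by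
  have hk : (0 : ℝ) ≤ k := Nat.cast_nonneg k
  have e : Set.EqOn (fun x : ℝ => Real.exp (-x) * x ^ ((k : ℝ) + α + 1 - 1))
      (fun x : ℝ => x ^ k * (x ^ α * Real.exp (-x))) (Set.Ioi 0) := by
    intro x hx
    have hx : 0 < x := hx
    simp only
    rw [show (k : ℝ) + α + 1 - 1 = k + α by ring, Real.rpow_add hx, Real.rpow_natCast]
    ring
  have h1 : (0 : ℝ) < k + α + 1 := by linarith
  constructor
  · exact (Real.GammaIntegral_convergent h1).congr_fun e measurableSet_Ioi
  · rw [Real.Gamma_eq_integral h1]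
    exact (setIntegral_congr_fun measurableSet_Ioi e).symm

lemma aux_pochhammer (z : ℝ) (hz : 0 < z) (m : ℕ) :
    Real.Gamma (z + m) = (ascPochhammer ℝ m).eval z * Real.Gamma z := by
  induction m with
  | zero => simp
  | succ m ih =>
    rw [ascPochhammer_succ_eval]
    push_cast
    rw [← add_assoc, Real.Gamma_add_one (by positivity), ih]
    ring

lemma aux_altsum (a : ℝ) (n m : ℕ) (hm : m ≤ n) :
    ∑ k ∈ Finset.range (n + 1), (-1 : ℝ) ^ k * (n.choose k) * (ascPochhammer ℝ m).eval (k + a)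
      = if m = n then (-1) ^ n * (n.factorial : ℝ) else 0 := by
  have h := fwdDiff_iter_eq_sum_shift (1 : ℝ) (ascPochhammer ℝ m).eval n a
  have h2 : ∑ k ∈ Finset.range (n + 1), (-1 : ℝ) ^ k * (n.choose k) * (ascPochhammer ℝ m).eval (k + a)
      = (-1) ^ n * (fwdDiff (1 : ℝ))^[n] (ascPochhammer ℝ m).eval a := by
    rw [h, Finset.mul_sum]
    refine Finset.sum_congr rfl fun k hk => ?_
    have hk : k ≤ n := by simp at hk; omega
    obtain ⟨j, rfl⟩ := Nat.exists_eq_add_of_le hk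
    simp only [zsmul_eq_mul, nsmul_eq_mul, mul_one, Int.cast_mul, Int.cast_pow, Int.cast_neg,
      Int.cast_one, Int.cast_natCast, Nat.add_sub_cancel_left]
    have : (-1 : ℝ) ^ j * (-1) ^ j = 1 := by rw [← mul_pow]; simp
    rw [pow_add, add_comm a]
    linear_combination (-(-1 : ℝ) ^ k * ((k + j).choose k) * (ascPochhammer ℝ m).eval (k + a)) * this
  rw [h2]
  split_ifs with hmn
  · subst hmn
    have := Polynomial.fwdDiff_iter_degree_eq_factorial (ascPochhammer ℝ m)
    rw [ascPochhammer_natDegree, (monic_ascPochhammer ℝ m).leadingCoeff] at this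
    rw [this]; simp
  · rw [Polynomial.fwdDiff_iter_eq_zero_of_degree_lt]
    · simp
    · rw [ascPochhammer_natDegree]; omega

lemma aux_lag_moment (α : ℝ) (hα : -1 < α) (n m : ℕ) (hm : m ≤ n) :
    IntegrableOn (fun x : ℝ => genLaguerre α n x * x ^ m * (x ^ α * Real.exp (-x))) (Set.Ioi 0) ∧
    ∫ x in Set.Ioi (0 : ℝ), genLaguerre α n x * x ^ m * (x ^ α * Real.exp (-x))
      = if m = n then (-1) ^ n * Real.Gamma (n + α + 1) else 0 := by
  have e : (fun x : ℝ => genLaguerre α n x * x ^ m * (x ^ α * Real.exp (-x)))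
      = fun x => ∑ k ∈ Finset.range (n + 1), (((-1 : ℝ) ^ k / (Nat.factorial k)) *
      (Real.Gamma (n + α + 1) / (Real.Gamma (k + α + 1) * (Nat.factorial (n - k))))) *
        (x ^ (k + m) * (x ^ α * Real.exp (-x))) := by
    funext x
    unfold genLaguerre
    rw [Finset.sum_mul, Finset.sum_mul]
    refine Finset.sum_congr rfl fun k _ => ?_
    rw [pow_add]; ring
  have hi : ∀ k ∈ Finset.range (n + 1), IntegrableOn (fun x : ℝ => (((-1 : ℝ) ^ k / (Nat.factorial k)) *
      (Real.Gamma (n + α + 1) / (Real.Gamma (k + α + 1) * (Nat.factorial (n - k))))) *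
        (x ^ (k + m) * (x ^ α * Real.exp (-x)))) (Set.Ioi 0) :=
    fun k _ => ((aux_moment α hα (k + m)).1).const_mul _
  rw [e]
  refine ⟨integrable_finsetSum _ hi, ?_⟩
  rw [integral_finsetSum _ hi]
  have e2 : ∀ k ∈ Finset.range (n + 1), ∫ x in Set.Ioi (0 : ℝ), (((-1 : ℝ) ^ k / (Nat.factorial k)) *
      (Real.Gamma (n + α + 1) / (Real.Gamma (k + α + 1) * (Nat.factorial (n - k))))) *
        (x ^ (k + m) * (x ^ α * Real.exp (-x))) = (Real.Gamma (n + α + 1) / n.factorial) *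
        ((-1 : ℝ) ^ k * (n.choose k) * (ascPochhammer ℝ m).eval (k + (α + 1))) := by
    intro k hk
    have hk : k ≤ n := by simp at hk; omega
    have hk0 : (0 : ℝ) ≤ k := Nat.cast_nonneg k
    have hG : 0 < Real.Gamma (k + α + 1) := Real.Gamma_pos_of_pos (by linarith)
    rw [integral_const_mul, (aux_moment α hα (k + m)).2]
    have := aux_pochhammer (k + α + 1) (by linarith) m
    rw [show ((k + m : ℕ) : ℝ) + α + 1 = k + α + 1 + m by push_cast; ring, this, ← add_assoc,
      Nat.cast_choose ℝ hk]
    field_simp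
  rw [Finset.sum_congr rfl e2, ← Finset.mul_sum, aux_altsum _ n m hm]
  split_ifs with h
  · field_simp
  · simp

lemma aux_orth_le (α : ℝ) (hα : -1 < α) (n m : ℕ) (hm : m ≤ n) :
    IntegrableOn (fun x : ℝ => lagPhi α n x * lagPhi α m x * (x ^ α * Real.exp (-x))) (Set.Ioi 0) ∧
    ∫ x in Set.Ioi (0 : ℝ), lagPhi α n x * lagPhi α m x * (x ^ α * Real.exp (-x))
      = if m = n then 1 else 0 := by
  have hn0 : (0 : ℝ) ≤ n := Nat.cast_nonneg n
  have hGn : 0 < Real.Gamma (n + α + 1) := Real.Gamma_pos_of_pos (by linarith)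
  set cn := Real.sqrt ((Nat.factorial n : ℝ) / Real.Gamma (n + α + 1)) with hcn
  set cm := Real.sqrt ((Nat.factorial m : ℝ) / Real.Gamma (m + α + 1)) with hcm
  have e : (fun x : ℝ => lagPhi α n x * lagPhi α m x * (x ^ α * Real.exp (-x)))
      = fun x => ∑ k ∈ Finset.range (m + 1), (cn * cm * (((-1 : ℝ) ^ k / (Nat.factorial k)) *
      (Real.Gamma (m + α + 1) / (Real.Gamma (k + α + 1) * (Nat.factorial (m - k)))))) *
        (genLaguerre α n x * x ^ k * (x ^ α * Real.exp (-x))) := by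
    funext x
    unfold lagPhi
    rw [← hcn, ← hcm]
    generalize genLaguerre α n x = L
    unfold genLaguerre
    simp only [Finset.mul_sum, Finset.sum_mul]
    refine Finset.sum_congr rfl fun k _ => ?_
    ring
  have hi : ∀ k ∈ Finset.range (m + 1), IntegrableOn (fun x : ℝ =>
      (cn * cm * (((-1 : ℝ) ^ k / (Nat.factorial k)) *
      (Real.Gamma (m + α + 1) / (Real.Gamma (k + α + 1) * (Nat.factorial (m - k)))))) *
        (genLaguerre α n x * x ^ k * (x ^ α * Real.exp (-x)))) (Set.Ioi 0) :=
    fun k hk => ((aux_lag_moment α hα n k (by simp at hk; omega)).1).const_mul _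
  rw [e]
  refine ⟨integrable_finsetSum _ hi, ?_⟩
  rw [integral_finsetSum _ hi, Finset.sum_range_succ, Finset.sum_eq_zero, zero_add]
  · rw [integral_const_mul, (aux_lag_moment α hα n m hm).2]
    split_ifs with h
    · subst h
      have hc : cn * cm = (Nat.factorial m : ℝ) / Real.Gamma (m + α + 1) := by
        rw [hcn, hcm]; exact Real.mul_self_sqrt (by positivity)
      have : (-1 : ℝ) ^ m * (-1) ^ m = 1 := by rw [← mul_pow]; simp
      rw [hc]
      simp only [Nat.sub_self, Nat.factorial_zero, Nat.cast_one, mul_one]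
      field_simp
      linear_combination this
    · simp
  · intro k hk
    have hk : k < m := by simpa using hk
    rw [integral_const_mul, (aux_lag_moment α hα n k (by omega)).2, if_neg (by omega), mul_zero]

lemma aux_orth (α : ℝ) (hα : -1 < α) (n m : ℕ) :
    IntegrableOn (fun x : ℝ => lagPhi α n x * lagPhi α m x * (x ^ α * Real.exp (-x))) (Set.Ioi 0) ∧
    ∫ x in Set.Ioi (0 : ℝ), lagPhi α n x * lagPhi α m x * (x ^ α * Real.exp (-x))
      = if n = m then 1 else 0 := by
  rcases le_total m n with h | h
  · simpa [eq_comm] using aux_orth_le α hα n m h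
  · have := aux_orth_le α hα m n h
    simpa [mul_comm] using this

/-- Partial sums of the kernel. -/
noncomputable def auxPart (α : ℝ) (q : ℍ[ℝ]) (y : ℝ) (N : ℕ) (x : ℝ) : ℍ[ℝ] :=
  ∑ n ∈ Finset.range N, (lagPhi α n x * lagPhi α n y) • q ^ n

lemma aux_lagPhi_cont (α : ℝ) (n : ℕ) : Continuous (lagPhi α n) := by
  unfold lagPhi genLaguerre
  fun_prop

lemma aux_part_cont (α : ℝ) (q : ℍ[ℝ]) (y : ℝ) (N : ℕ) : Continuous (auxPart α q y N) := by
  unfold auxPart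
  have := aux_lagPhi_cont α
  fun_prop

lemma aux_part_norm (α : ℝ) (hα : -1 < α) (q : ℍ[ℝ]) (y : ℝ) (N : ℕ) :
    IntegrableOn (fun x : ℝ => ‖auxPart α q y N x‖ ^ 2 * (x ^ α * Real.exp (-x))) (Set.Ioi 0) ∧
    ∫ x in Set.Ioi (0 : ℝ), ‖auxPart α q y N x‖ ^ 2 * (x ^ α * Real.exp (-x))
      = ∑ n ∈ Finset.range N, ‖q‖ ^ (2 * n) * (lagPhi α n y) ^ 2 := by
  have e : (fun x : ℝ => ‖auxPart α q y N x‖ ^ 2 * (x ^ α * Real.exp (-x)))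
      = fun x => ∑ n ∈ Finset.range N, ∑ m ∈ Finset.range N,
        (lagPhi α n y * lagPhi α m y * inner ℝ (q ^ n) (q ^ m)) *
          (lagPhi α n x * lagPhi α m x * (x ^ α * Real.exp (-x))) := by
    funext x
    rw [← real_inner_self_eq_norm_sq]
    unfold auxPart
    simp only [sum_inner, inner_sum, real_inner_smul_left, real_inner_smul_right, Finset.sum_mul]
    rw [Finset.sum_comm]
    refine Finset.sum_congr rfl fun n _ => Finset.sum_congr rfl fun m _ => ?_
    rw [real_inner_comm]
    ring
  have hi : ∀ n ∈ Finset.range N, ∀ m ∈ Finset.range N, IntegrableOn (fun x : ℝ =>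
      (lagPhi α n y * lagPhi α m y * inner ℝ (q ^ n) (q ^ m)) *
          (lagPhi α n x * lagPhi α m x * (x ^ α * Real.exp (-x)))) (Set.Ioi 0) :=
    fun n _ m _ => ((aux_orth α hα n m).1).const_mul _
  rw [e]
  refine ⟨integrable_finsetSum _ fun n hn => integrable_finsetSum _ (hi n hn), ?_⟩
  rw [integral_finsetSum _ fun n hn => integrable_finsetSum _ (hi n hn)]
  refine Finset.sum_congr rfl fun n hn => ?_
  rw [integral_finsetSum _ (hi n hn)]
  simp only [integral_const_mul, (aux_orth α hα n _).2]
  simp only [mul_ite, mul_one, mul_zero, Finset.sum_ite_eq, hn, if_true]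
  rw [real_inner_self_eq_norm_sq, norm_pow]
  ring

lemma aux_part_tendsto (α : ℝ) (hα : -1 < α) (q : ℍ[ℝ]) (hq : ‖q‖ < 1) (x y : ℝ) :
    Filter.Tendsto (fun N => auxPart α q y N x) Filter.atTop (nhds (Rker α q x y)) := by
  unfold auxPart Rker
  apply HasSum.tendsto_sum_nat
  apply Summable.hasSum
  apply Summable.of_norm
  refine Summable.of_nonneg_of_le (fun _ => norm_nonneg _) (fun n => ?_)
    ((aux_summable α hα x ‖q‖ (norm_nonneg _) hq).add (aux_summable α hα y ‖q‖ (norm_nonneg _) hq))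
  rw [norm_smul, norm_pow, ← mul_add, mul_comm, Real.norm_eq_abs]
  apply mul_le_mul_of_nonneg_left _ (by positivity)
  rw [abs_le]
  constructor <;> nlinarith [sq_nonneg (lagPhi α n x + lagPhi α n y),
    sq_nonneg (lagPhi α n x - lagPhi α n y), sq_nonneg (lagPhi α n x), sq_nonneg (lagPhi α n y)]

lemma aux_ker_meas (α : ℝ) (hα : -1 < α) (q : ℍ[ℝ]) (hq : ‖q‖ < 1) (y : ℝ) :
    StronglyMeasurable (fun x => Rker α q x y) :=
  stronglyMeasurable_of_tendsto Filter.atTop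
    (fun N => (aux_part_cont α q y N).stronglyMeasurable)
    (tendsto_pi_nhds.2 fun x => aux_part_tendsto α hα q hq x y)

lemma aux_ker_L2 (α y : ℝ) (hα : -1 < α) (q : ℍ[ℝ]) (hq : ‖q‖ < 1) :
    IntegrableOn (fun x : ℝ => ‖Rker α q x y‖ ^ 2 * (x ^ α * Real.exp (-x))) (Set.Ioi 0) ∧
    ∫ x in Set.Ioi (0 : ℝ), ‖Rker α q x y‖ ^ 2 * (x ^ α * Real.exp (-x))
      ≤ ∑' n : ℕ, ‖q‖ ^ (2 * n) * (lagPhi α n y) ^ 2 := by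
  set T := ∑' n : ℕ, ‖q‖ ^ (2 * n) * (lagPhi α n y) ^ 2 with hT
  have hsum : Summable fun n : ℕ => ‖q‖ ^ (2 * n) * (lagPhi α n y) ^ 2 := by
    have := aux_summable α hα y (‖q‖ ^ 2) (by positivity) (by
      have := norm_nonneg q
      nlinarith)
    simpa only [← pow_mul] using this
  have hT0 : 0 ≤ T := tsum_nonneg fun n => by positivity
  have hw : Measurable fun x : ℝ => x ^ α * Real.exp (-x) := by fun_prop
  have hnn : ∀ v : ℝ → ℍ[ℝ], ∀ᵐ x ∂(volume.restrict (Set.Ioi (0 : ℝ))),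
      0 ≤ ‖v x‖ ^ 2 * (x ^ α * Real.exp (-x)) := by
    intro v
    filter_upwards [ae_restrict_mem measurableSet_Ioi] with x hx
    have hx : 0 < x := hx
    positivity
  have hR : Measurable fun x => ‖Rker α q x y‖ :=
    (aux_ker_meas α hα q hq y).norm.measurable
  have hF : ∫⁻ x in Set.Ioi (0 : ℝ), ENNReal.ofReal (‖Rker α q x y‖ ^ 2 * (x ^ α * Real.exp (-x)))
      ≤ ENNReal.ofReal T := by
    have hlim : ∀ x, Filter.liminf (fun N => ENNReal.ofReal (‖auxPart α q y N x‖ ^ 2 * (x ^ α * Real.exp (-x)))) Filter.atTop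
        = ENNReal.ofReal (‖Rker α q x y‖ ^ 2 * (x ^ α * Real.exp (-x))) := by
      intro x
      apply Filter.Tendsto.liminf_eq
      apply ENNReal.tendsto_ofReal
      exact (((aux_part_tendsto α hα q hq x y).norm.pow 2).mul_const _)
    simp_rw [← hlim]
    refine (lintegral_liminf_le fun N => ?_).trans ?_
    · have := (aux_part_cont α q y N).norm.measurable
      exact ((this.pow_const 2).mul hw).ennreal_ofReal
    · refine Filter.liminf_le_of_frequently_le' (Filter.Frequently.of_forall fun N => ?_)
      obtain ⟨h1, h2⟩ := aux_part_norm α hα q y N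
      rw [← ofReal_integral_eq_lintegral_ofReal h1 (hnn _), h2]
      exact ENNReal.ofReal_le_ofReal (hsum.sum_le_tsum _ fun n _ => by positivity)
  have hm : AEStronglyMeasurable (fun x : ℝ => ‖Rker α q x y‖ ^ 2 * (x ^ α * Real.exp (-x)))
      (volume.restrict (Set.Ioi (0 : ℝ))) :=
    ((hR.pow_const 2).mul hw).aestronglyMeasurable
  have hint : IntegrableOn (fun x : ℝ => ‖Rker α q x y‖ ^ 2 * (x ^ α * Real.exp (-x))) (Set.Ioi 0) := by
    refine ⟨hm, ?_⟩
    rw [hasFiniteIntegral_iff_ofReal (hnn _)]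
    exact hF.trans_lt ENNReal.ofReal_lt_top
  refine ⟨hint, ?_⟩
  rw [integral_eq_lintegral_of_nonneg_ae (hnn _) hm]
  exact ENNReal.toReal_le_of_le_ofReal hT0 hF

/-- Well-definedness and pointwise bound for the dual transform `S_y^α`. -/
theorem stmt_5 (α y : ℝ) (hα : -1 < α) (hy : 0 ≤ y) (φ : ℝ → ℍ[ℝ])
    (hmeas : AEStronglyMeasurable φ (volume.restrict (Set.Ioi 0)))
    (hL2 : (∫⁻ x in Set.Ioi (0 : ℝ),
      ENNReal.ofReal (‖φ x‖ ^ 2 * (x ^ α * Real.exp (-x)))) < ⊤)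
    (q : ℍ[ℝ]) (hq : ‖q‖ < 1) :
    IntegrableOn (fun x : ℝ => (x ^ α * Real.exp (-x)) • (Rker α q x y * φ x))
        (Set.Ioi 0) ∧
    ‖Sdual α y φ q‖ ^ 2 ≤ (∑' n : ℕ, ‖q‖ ^ (2 * n) * (lagPhi α n y) ^ 2) *
      ∫ x in Set.Ioi (0 : ℝ), ‖φ x‖ ^ 2 * (x ^ α * Real.exp (-x)) := by
  obtain ⟨hR1, hR2⟩ := aux_ker_L2 α y hα q hq
  have hwm : Measurable fun x : ℝ => x ^ α * Real.exp (-x) := by fun_prop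
  have hRm := aux_ker_meas α hα q hq y
  have hwpos : ∀ᵐ x ∂(volume.restrict (Set.Ioi (0 : ℝ))), 0 < x ^ α * Real.exp (-x) := by
    filter_upwards [ae_restrict_mem measurableSet_Ioi] with x hx
    have hx : 0 < x := hx
    positivity
  have hφm : AEStronglyMeasurable (fun x : ℝ => ‖φ x‖ ^ 2 * (x ^ α * Real.exp (-x)))
      (volume.restrict (Set.Ioi (0 : ℝ))) :=
    (hmeas.norm.pow 2).mul hwm.aestronglyMeasurable
  have hφ : IntegrableOn (fun x : ℝ => ‖φ x‖ ^ 2 * (x ^ α * Real.exp (-x))) (Set.Ioi 0) := by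
    refine ⟨hφm, ?_⟩
    rw [hasFiniteIntegral_iff_ofReal]
    · exact hL2
    · filter_upwards [hwpos] with x hx
      positivity
  set f : ℝ → ℝ := fun x => Real.sqrt (x ^ α * Real.exp (-x)) * ‖Rker α q x y‖ with hf
  set g : ℝ → ℝ := fun x => Real.sqrt (x ^ α * Real.exp (-x)) * ‖φ x‖ with hg
  have hf2 : (fun x => f x ^ 2) =ᵐ[volume.restrict (Set.Ioi (0 : ℝ))]
      fun x => ‖Rker α q x y‖ ^ 2 * (x ^ α * Real.exp (-x)) := by
    filter_upwards [hwpos] with x hx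
    rw [hf]
    simp only
    rw [mul_pow, Real.sq_sqrt hx.le, mul_comm]
  have hg2 : (fun x => g x ^ 2) =ᵐ[volume.restrict (Set.Ioi (0 : ℝ))]
      fun x => ‖φ x‖ ^ 2 * (x ^ α * Real.exp (-x)) := by
    filter_upwards [hwpos] with x hx
    rw [hg]
    simp only
    rw [mul_pow, Real.sq_sqrt hx.le, mul_comm]
  have hfm : AEStronglyMeasurable f (volume.restrict (Set.Ioi (0 : ℝ))) :=
    hwm.sqrt.aestronglyMeasurable.mul hRm.norm.aestronglyMeasurable
  have hgm : AEStronglyMeasurable g (volume.restrict (Set.Ioi (0 : ℝ))) :=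
    hwm.sqrt.aestronglyMeasurable.mul hmeas.norm
  have hfL : MemLp f 2 (volume.restrict (Set.Ioi (0 : ℝ))) :=
    (memLp_two_iff_integrable_sq hfm).2 (hR1.congr hf2.symm)
  have hgL : MemLp g 2 (volume.restrict (Set.Ioi (0 : ℝ))) :=
    (memLp_two_iff_integrable_sq hgm).2 (hφ.congr hg2.symm)
  have hfg : Integrable (fun x => f x * g x) (volume.restrict (Set.Ioi (0 : ℝ))) :=
    hfL.integrable_mul hgL
  have hnorm : ∀ᵐ x ∂(volume.restrict (Set.Ioi (0 : ℝ))),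
      ‖(x ^ α * Real.exp (-x)) • (Rker α q x y * φ x)‖ = f x * g x := by
    filter_upwards [hwpos] with x hx
    rw [norm_smul, Real.norm_of_nonneg hx.le, norm_mul, hf, hg]
    simp only
    have hs := Real.mul_self_sqrt hx.le
    linear_combination (-(‖Rker α q x y‖ * ‖φ x‖)) * hs
  have hmain : IntegrableOn (fun x : ℝ => (x ^ α * Real.exp (-x)) • (Rker α q x y * φ x))
        (Set.Ioi 0) := by
    refine hfg.mono' ?_ ?_
    · exact hwm.aestronglyMeasurable.smul (hRm.aestronglyMeasurable.mul hmeas)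
    · filter_upwards [hnorm] with x hx
      exact hx.le
  refine ⟨hmain, ?_⟩
  have h1 : ‖Sdual α y φ q‖ ≤ ∫ x in Set.Ioi (0 : ℝ), f x * g x := by
    unfold Sdual
    exact (norm_integral_le_integral_norm _).trans_eq (integral_congr_ae hnorm)
  have h2 := integral_mul_le_Lp_mul_Lq_of_nonneg (μ := volume.restrict (Set.Ioi (0 : ℝ)))
    Real.HolderConjugate.two_two (f := f) (g := g)
    (Filter.Eventually.of_forall fun x => by simp only [hf, Pi.zero_apply]; positivity)
    (Filter.Eventually.of_forall fun x => by simp only [hg, Pi.zero_apply]; positivity)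
    (by simpa using hfL) (by simpa using hgL)
  simp only [Real.rpow_two, ← Real.sqrt_eq_rpow] at h2
  rw [integral_congr_ae hf2, integral_congr_ae hg2] at h2
  have hA : 0 ≤ ∫ x in Set.Ioi (0 : ℝ), ‖Rker α q x y‖ ^ 2 * (x ^ α * Real.exp (-x)) :=
    integral_nonneg_of_ae (by filter_upwards [hwpos] with x hx; simp only [Pi.zero_apply]; positivity)
  have hB : 0 ≤ ∫ x in Set.Ioi (0 : ℝ), ‖φ x‖ ^ 2 * (x ^ α * Real.exp (-x)) :=
    integral_nonneg_of_ae (by filter_upwards [hwpos] with x hx; simp only [Pi.zero_apply]; positivity)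
  calc ‖Sdual α y φ q‖ ^ 2 ≤ _ ^ 2 := pow_le_pow_left₀ (norm_nonneg _) (h1.trans h2) 2
    _ = _ := by rw [mul_pow, Real.sq_sqrt hA, Real.sq_sqrt hB]
    _ ≤ _ := mul_le_mul_of_nonneg_right hR2 hB
end
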